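/- arXiv:math/0601751 — 3 statements merged into one kernel-verified Lean document; each statement's English description precedes it below -/
import Mathlib

section
/- Let n ≥ 3, let 1 ≤ k ≤ n−1, and let U ⊆ ℝⁿ be open. A smooth map σ from U to k-forms satisfies the flat conformal Killing equation if and only if there exist smooth maps μ (valued in (k+1)-forms), ν (valued in (k−1)-forms) and ρ (valued in k-forms) on U such that for all x ∈ U and all c, a₀, a₁, …, aₖ ∈ ℝⁿ: (i) (Dσ(x)c)(a₁,…,aₖ) = μ(x)(c,a₁,…,aₖ) + (1/k) Σ_{i=1}^{k} (−1)^{i+1} ⟨c,aᵢ⟩ ν(x)(a₁,…,âᵢ,…,aₖ); (ii) (Dμ(x)c)(a₀,a₁,…,aₖ) = Σ_{i=0}^{k} (−1)^{i} ⟨c,aᵢ⟩ ρ(x)(a₀,…,âᵢ,…,aₖ); (iii) (Dν(x)c)(a₂,…,aₖ) = −k·ρ(x)(c,a₂,…,aₖ); (iv) Dρ(x) = 0. Moreover, when they exist, μ, ν, ρ are uniquely determined by σ. (This is the conformally flat instance of the prolongation of the conformal Killing equation to a first-order closed system.) -/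
open scoped RealInnerProductSpace BigOperators

noncomputable section

/-- Euclidean `n`-space. -/
abbrev Euc (n : ℕ) : Type := EuclideanSpace ℝ (Fin n)

/-- Continuous `k`-linear maps `(ℝⁿ)ᵏ → ℝ`. -/
abbrev FormML (n k : ℕ) : Type :=
  ContinuousMultilinearMap ℝ (fun _ : Fin k => Euc n) ℝ

/-- A multilinear map is alternating (vanishes when two arguments coincide);
together with multilinearity this makes it a `k`-form. -/
def IsAlt {n k : ℕ} (f : FormML n k) : Prop :=
  ∀ (v : Fin k → Euc n) (i j : Fin k), i ≠ j → v i = v j → f v = 0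

/-- The tuple `a` with its `i`-th entry omitted. -/
def omitArg {X : Type*} {k : ℕ} (i : Fin k) (a : Fin k → X) (j : Fin (k - 1)) : X :=
  if (j : ℕ) < (i : ℕ) then a ⟨j, by have := j.isLt; have := i.isLt; omega⟩
  else a ⟨(j : ℕ) + 1, by have := j.isLt; omega⟩

/-- The tuple `(c, d₁, …, d_{k-1})`. -/
def consCast {X : Type*} {k : ℕ} (c : X) (d : Fin (k - 1) → X) (j : Fin k) : X :=
  if h : (j : ℕ) = 0 then c else d ⟨(j : ℕ) - 1, by have := j.isLt; omega⟩

/-- The flat (Euclidean) conformal Killing equation on `k`-forms: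
`σ` is smooth on `U`, valued in alternating maps, and there are smooth form-valued
`τ` (degree `k-1`) and `ρ` (degree `k+1`) with
`(Dσ(x)c)(a₁,…,a_k) = Σᵢ (-1)^(i+1) ⟨c,aᵢ⟩ τ(x)(a₁,…,âᵢ,…,a_k) + ρ(x)(c,a₁,…,a_k)`. -/
def FlatCKF (n k : ℕ) (U : Set (Euc n)) (σ : Euc n → FormML n k) : Prop :=
  ContDiffOn ℝ (⊤ : ℕ∞) σ U ∧ (∀ x ∈ U, IsAlt (σ x)) ∧
  ∃ (τ : Euc n → FormML n (k - 1)) (ρ : Euc n → FormML n (k + 1)),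
    ContDiffOn ℝ (⊤ : ℕ∞) τ U ∧ ContDiffOn ℝ (⊤ : ℕ∞) ρ U ∧
    (∀ x ∈ U, IsAlt (τ x)) ∧ (∀ x ∈ U, IsAlt (ρ x)) ∧
    ∀ x ∈ U, ∀ (c : Euc n) (a : Fin k → Euc n),
      (fderiv ℝ σ x c) a =
        (∑ i : Fin k, (-1 : ℝ) ^ (i : ℕ) * ⟪c, a i⟫ * τ x (omitArg i a))
        + ρ x (consCast c a)

/-- The closed first-order prolonged system for the flat conformal Killing equation:
(i)   Dσ = μ + g·ν,
(ii)  Dμ = alternated trace terms in ρ,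
(iii) Dν = -k ρ,
(iv)  Dρ = 0,
with all of `μ, ν, ρ` smooth and alternating on `U`. -/
def ProlongSys (n k : ℕ) (U : Set (Euc n)) (σ : Euc n → FormML n k)
    (μ : Euc n → FormML n (k + 1)) (ν : Euc n → FormML n (k - 1))
    (ρ : Euc n → FormML n k) : Prop :=
  ContDiffOn ℝ (⊤ : ℕ∞) μ U ∧ ContDiffOn ℝ (⊤ : ℕ∞) ν U ∧ ContDiffOn ℝ (⊤ : ℕ∞) ρ U ∧
  (∀ x ∈ U, IsAlt (μ x)) ∧ (∀ x ∈ U, IsAlt (ν x)) ∧ (∀ x ∈ U, IsAlt (ρ x)) ∧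
  (∀ x ∈ U, ∀ (c : Euc n) (a : Fin k → Euc n),
    (fderiv ℝ σ x c) a =
      μ x (consCast c a)
      + (1 / (k : ℝ)) * ∑ i : Fin k, (-1 : ℝ) ^ (i : ℕ) * ⟪c, a i⟫ * ν x (omitArg i a)) ∧
  (∀ x ∈ U, ∀ (c : Euc n) (b : Fin (k + 1) → Euc n),
    (fderiv ℝ μ x c) b =
      ∑ i : Fin (k + 1), (-1 : ℝ) ^ (i : ℕ) * ⟪c, b i⟫ * ρ x (omitArg i b)) ∧
  (∀ x ∈ U, ∀ (c : Euc n) (d : Fin (k - 1) → Euc n),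
    (fderiv ℝ ν x c) d = -(k : ℝ) * ρ x (consCast c d)) ∧
  (∀ x ∈ U, fderiv ℝ ρ x = 0)

open Fin Function

section Arguments

theorem omitArg_eq_removeNth {X : Type*} {m : ℕ} (i : Fin (m + 1)) (a : Fin (m + 1) → X) :
    omitArg i a = i.removeNth a := by
  funext j
  unfold omitArg Fin.removeNth Fin.succAbove
  by_cases h : (j : ℕ) < (i : ℕ)
  · rw [if_pos h, if_pos (show j.castSucc < i from h)]
    rfl
  · rw [if_neg h, if_neg (show ¬ j.castSucc < i from h)]
    rfl

theorem consCast_eq_cons {X : Type*} {m : ℕ} (c : X) (d : Fin m → X) :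
    consCast (k := m + 1) c d = (Fin.cons c d : Fin (m + 1) → X) := by
  funext j
  refine Fin.cases ?_ (fun i => ?_) j
  · simp [consCast]
  · simp [consCast]

end Arguments

section Forms

variable {n m : ℕ}

/-- The alternating map underlying a form. -/
def IsAlt.toAlternatingMap {f : FormML n m} (hf : IsAlt f) : Euc n [⋀^Fin m]→ₗ[ℝ] ℝ :=
  { f.toMultilinearMap with map_eq_zero_of_eq' := fun v i j h hij => hf v i j hij h }

@[simp]
theorem IsAlt.toAlternatingMap_apply {f : FormML n m} (hf : IsAlt f) (v : Fin m → Euc n) :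
    hf.toAlternatingMap v = f v := rfl

theorem IsAlt.map_swap {f : FormML n m} (hf : IsAlt f) (v : Fin m → Euc n) {i j : Fin m}
    (hij : i ≠ j) : f (v ∘ Equiv.swap i j) = -f v :=
  hf.toAlternatingMap.map_swap v hij

theorem IsAlt.map_cons_cons_swap {f : FormML n (m + 2)} (hf : IsAlt f) (c d : Euc n)
    (w : Fin m → Euc n) :
    f (cons c (cons d w : Fin (m + 1) → Euc n)) =
      -f (cons d (cons c w : Fin (m + 1) → Euc n)) := by
  rw [← hf.map_swap _ (i := 0) (j := 1) (by simp)]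
  congr 1
  funext j
  refine Fin.cases ?_ (fun j => Fin.cases ?_ (fun j => ?_) j) j
  · simp only [comp_apply, Equiv.swap_apply_left, cons_zero]
    rfl
  · simp only [comp_apply, succ_zero_eq_one, Equiv.swap_apply_right, cons_zero]
    rfl
  · rw [comp_apply, Equiv.swap_apply_of_ne_of_ne (by simp [Fin.ext_iff]) (by simp [Fin.ext_iff])]
    rfl

theorem IsAlt.map_update_update_swap {f : FormML n m} (hf : IsAlt f) (a : Fin m → Euc n)
    {i j : Fin m} (hij : i ≠ j) (x : Euc n) :
    f (update (update a j (a i)) i x) = -f (update a j x) := by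
  rw [← hf.map_swap _ hij]
  congr 1
  funext l
  simp only [comp_apply, update_apply, Equiv.swap_apply_def]
  grind

/-- Moving the leading argument into the place of a removed one. -/
theorem IsAlt.neg_one_pow_mul_map_cons_removeNth {f : FormML n (m + 1)} (hf : IsAlt f)
    (x : Euc n) (a : Fin (m + 1) → Euc n) (i : Fin (m + 1)) :
    (-1) ^ (i : ℕ) * f (cons x (i.removeNth a)) = f (update a i x) := by
  rw [← Fin.insertNth_removeNth]
  simpa [Matrix.vecCons] using (hf.toAlternatingMap.map_insertNth i x (i.removeNth a)).symm

/-- The value at `a` of the wedge product of the covector `⟪c, ·⟫` with a form. -/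
def wedge (c : Euc n) (f : FormML n m) (a : Fin (m + 1) → Euc n) : ℝ :=
  ∑ i : Fin (m + 1), (-1 : ℝ) ^ (i : ℕ) * ⟪c, a i⟫ * f (i.removeNth a)

/-- `wedge c f a` as a continuous linear function of `f`. -/
def wedgeCLM (c : Euc n) (a : Fin (m + 1) → Euc n) : FormML n m →L[ℝ] ℝ :=
  ∑ i : Fin (m + 1), ((-1 : ℝ) ^ (i : ℕ) * ⟪c, a i⟫) •
    ContinuousMultilinearMap.apply ℝ (fun _ : Fin m => Euc n) ℝ (i.removeNth a)

theorem wedgeCLM_apply (c : Euc n) (a : Fin (m + 1) → Euc n) (f : FormML n m) :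
    wedgeCLM c a f = wedge c f a := by
  simp [wedgeCLM, wedge, ContinuousMultilinearMap.apply]

theorem wedge_smul (c : Euc n) (r : ℝ) (f : FormML n m) (a : Fin (m + 1) → Euc n) :
    wedge c (r • f) a = r * wedge c f a := by
  simp only [← wedgeCLM_apply, map_smul, smul_eq_mul]

theorem wedge_sub (c : Euc n) (f g : FormML n m) (a : Fin (m + 1) → Euc n) :
    wedge c (f - g) a = wedge c f a - wedge c g a := by
  simp only [← wedgeCLM_apply, map_sub]

theorem wedge_cons {f : FormML n m} (hf : IsAlt f) (c x : Euc n) (a : Fin m → Euc n) :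
    wedge c f (cons x a) = ⟪c, x⟫ * f a - ∑ i, ⟪c, a i⟫ * f (update a i x) := by
  rw [wedge, Fin.sum_univ_succ, sub_eq_add_neg, ← Finset.sum_neg_distrib]
  congr 1
  · simp
  · refine Finset.sum_congr rfl fun i _ => ?_
    cases m with
    | zero => exact i.elim0
    | succ m =>
      have h : i.succ.removeNth (cons x a : Fin (m + 2) → Euc n) = cons x (i.removeNth a) := by
        funext j
        refine Fin.cases ?_ (fun j => ?_) j
        · simp [removeNth]
        · simp [removeNth]
      rw [h, ← hf.neg_one_pow_mul_map_cons_removeNth, cons_succ, val_succ]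
      ring

theorem wedge_cons_cons_swap {f : FormML n (m + 1)} (hf : IsAlt f) (b c d : Euc n)
    (w : Fin m → Euc n) :
    wedge b f (cons c (cons d w : Fin (m + 1) → Euc n)) =
      -wedge b f (cons d (cons c w : Fin (m + 1) → Euc n)) := by
  have h : ∀ (i : Fin m) (x y : Euc n),
      f (update (cons x w : Fin (m + 1) → Euc n) i.succ y) = f (cons x (update w i y)) :=
    fun i x y => by rw [cons_update]
  have hswap : ∀ i : Fin m, f (cons c (update w i d)) = -f (cons d (update w i c)) := fun i => by
    have := hf.map_update_update_swap (cons d w) (succ_ne_zero i).symm c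
    rwa [cons_zero, ← cons_update, update_cons_zero, h] at this
  rw [wedge_cons hf, wedge_cons hf, Fin.sum_univ_succ, Fin.sum_univ_succ]
  simp only [cons_zero, cons_succ, h, hswap, update_cons_zero, mul_neg, Finset.sum_neg_distrib]
  ring

/-- A function symmetric in its first two arguments and skew in the next two vanishes. -/
theorem eq_zero_of_symm_of_skew {X : Type*} (F : X → X → X → ℝ)
    (hsymm : ∀ b c d, F b c d = F c b d) (hskew : ∀ b c d, F b c d = -F b d c) (b c d : X) :
    F b c d = 0 := by
  linarith [hskew b c d, hsymm b d c, hskew d b c, hsymm d c b, hskew c d b, hsymm c b d]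

/-- Expansion of a linear functional in the standard orthonormal basis. -/
theorem sum_inner_basisFun_mul (L : Euc n →ₗ[ℝ] ℝ) (v : Euc n) :
    ∑ e, ⟪EuclideanSpace.basisFun (Fin n) ℝ e, v⟫ * L (EuclideanSpace.basisFun (Fin n) ℝ e) =
      L v := by
  conv_rhs => rw [← (EuclideanSpace.basisFun (Fin n) ℝ).sum_repr' v]
  rw [map_sum]
  exact Finset.sum_congr rfl fun e _ => by rw [map_smul, smul_eq_mul]

theorem sum_inner_basisFun_mul_update (f : FormML n m) (a : Fin m → Euc n) (i : Fin m)
    (v : Euc n) :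
    ∑ e, ⟪EuclideanSpace.basisFun (Fin n) ℝ e, v⟫ *
      f (update a i (EuclideanSpace.basisFun (Fin n) ℝ e)) = f (update a i v) :=
  sum_inner_basisFun_mul (f.toMultilinearMap.toLinearMap a i) v

theorem sum_wedge_basisFun_cons {f : FormML n m} (hf : IsAlt f) (a : Fin m → Euc n) :
    ∑ e, wedge (EuclideanSpace.basisFun (Fin n) ℝ e) f
      (cons (EuclideanSpace.basisFun (Fin n) ℝ e) a) = ((n : ℝ) - m) * f a := by
  simp only [wedge_cons hf, Finset.sum_sub_distrib]
  rw [Finset.sum_comm]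
  simp only [sum_inner_basisFun_mul_update, update_eq_self]
  simp
  ring

theorem eq_zero_of_wedge_basisFun_eq_zero {f : FormML n m} (hf : IsAlt f) (hm : m < n)
    (h : ∀ c a, wedge c f (cons c a) = 0) : f = 0 := by
  ext a
  have hsum := sum_wedge_basisFun_cons hf a
  have hnm : (m : ℝ) < n := by exact_mod_cast hm
  simp only [h, Finset.sum_const_zero] at hsum
  rcases mul_eq_zero.1 hsum.symm with h0 | h0
  · linarith
  · simpa using h0

/-- The contraction `∑ₑ ι_e (B e)` of a form-valued map. -/
def contraction (B : Euc n → FormML n (m + 1)) : FormML n m :=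
  ∑ e, continuousMultilinearCurryLeftEquiv ℝ (fun _ : Fin (m + 1) => Euc n) ℝ
    (B (EuclideanSpace.basisFun (Fin n) ℝ e)) (EuclideanSpace.basisFun (Fin n) ℝ e)

theorem contraction_apply (B : Euc n → FormML n (m + 1)) (a : Fin m → Euc n) :
    contraction B a = ∑ e, B (EuclideanSpace.basisFun (Fin n) ℝ e)
      (cons (EuclideanSpace.basisFun (Fin n) ℝ e) a) := by
  simp [contraction]

theorem IsAlt.map_cons {f : FormML n (m + 1)} (hf : IsAlt f) (c : Euc n) {a : Fin m → Euc n}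
    {i j : Fin m} (hij : i ≠ j) (h : a i = a j) : f (cons c a) = 0 :=
  hf _ i.succ j.succ (by simpa using hij) (by simpa using h)

theorem isAlt_contraction {B : Euc n → FormML n (m + 1)} (hB : ∀ b, IsAlt (B b)) :
    IsAlt (contraction B) := fun v i j hij h => by
  rw [contraction_apply]
  exact Finset.sum_eq_zero fun e _ => (hB _).map_cons _ hij h

section FirstProlongation

variable {A : Euc n →L[ℝ] FormML n m} {B : Euc n →L[ℝ] FormML n (m + 2)}

/-- The trace of the integrability condition for conformal Killing forms. -/
theorem trace_integrability (hA : ∀ b, IsAlt (A b)) (hB : ∀ b, IsAlt (B b))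
    (hAB : ∀ (b c : Euc n) (a : Fin (m + 1) → Euc n),
      wedge c (A b) a + B b (cons c a) = wedge b (A c) a + B c (cons b a))
    (b : Euc n) (a : Fin m → Euc n) :
    ((n : ℝ) - m - 1) * A b a =
      -∑ i, ⟪b, a i⟫ * ∑ e, A (EuclideanSpace.basisFun (Fin n) ℝ e)
          (update a i (EuclideanSpace.basisFun (Fin n) ℝ e))
        - contraction B (cons b a) := by
  set E := EuclideanSpace.basisFun (Fin n) ℝ
  have h := Finset.sum_congr (rfl : (Finset.univ : Finset (Fin n)) = _)
    fun e _ => hAB b (E e) (cons (E e) a)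
  have hz : ∀ e, B b (cons (E e) (cons (E e) a : Fin (m + 1) → Euc n)) = 0 := fun e =>
    hB b _ 0 1 (by simp) rfl
  simp only [hz, add_zero] at h
  rw [sum_wedge_basisFun_cons (hA b), Finset.sum_add_distrib] at h
  simp only [wedge_cons (hA _), (hB _).map_cons_cons_swap b, Finset.sum_sub_distrib,
    Finset.sum_neg_distrib] at h
  rw [← contraction_apply, Finset.sum_comm] at h
  have h1 : ∑ e, ⟪b, E e⟫ * A (E e) a = A b a := by
    simp only [real_inner_comm _ b]
    exact sum_inner_basisFun_mul
      (((ContinuousMultilinearMap.apply ℝ (fun _ : Fin m => Euc n) ℝ a).comp A : Euc n →L[ℝ] ℝ) :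
        Euc n →ₗ[ℝ] ℝ) b
  simp only [Finset.mul_sum]
  linarith

/-- The integrability condition forces the divergence of `A` to vanish. -/
theorem sum_map_update_basisFun_eq_zero (hm : m < n) (hA : ∀ b, IsAlt (A b))
    (hB : ∀ b, IsAlt (B b))
    (hAB : ∀ (b c : Euc n) (a : Fin (m + 1) → Euc n),
      wedge c (A b) a + B b (cons c a) = wedge b (A c) a + B c (cons b a))
    (a : Fin m → Euc n) (j : Fin m) :
    ∑ e, A (EuclideanSpace.basisFun (Fin n) ℝ e)
      (update a j (EuclideanSpace.basisFun (Fin n) ℝ e)) = 0 := by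
  set E := EuclideanSpace.basisFun (Fin n) ℝ
  set D : Fin m → (Fin m → Euc n) → ℝ := fun i a => ∑ e, A (E e) (update a i (E e)) with hD
  have h := Finset.sum_congr (rfl : (Finset.univ : Finset (Fin n)) = _)
    fun e _ => trace_integrability hA hB hAB (E e) (update a j (E e))
  have hz : ∀ e, contraction B (cons (E e) (update a j (E e))) = 0 := fun e =>
    isAlt_contraction hB _ 0 j.succ (succ_ne_zero j).symm (by simp)
  have hterm : ∀ i, ∑ e, ⟪E e, update a j (E e) i⟫ * D i (update a j (E e)) =
      if i = j then (n : ℝ) * D j a else -D j a := fun i => by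
    split_ifs with hij
    · subst hij
      simp [hD]
    · simp only [hD, update_of_ne hij, Finset.mul_sum]
      rw [Finset.sum_comm, ← Finset.sum_neg_distrib]
      refine Finset.sum_congr rfl fun e _ => ?_
      simp only [update_comm (Ne.symm hij)]
      rw [sum_inner_basisFun_mul_update, update_comm hij, (hA _).map_update_update_swap a hij]
  simp only [hz, sub_zero, ← Finset.mul_sum, Finset.sum_neg_distrib] at h
  rw [Finset.sum_comm] at h
  have hsum : ∑ i, (if i = j then (n : ℝ) * D j a else -D j a) = ((n : ℝ) - (m - 1)) * D j a := by
    rw [← Finset.add_sum_erase _ _ (Finset.mem_univ j), if_pos rfl,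
      Finset.sum_congr rfl fun i hi => if_neg (Finset.ne_of_mem_erase hi), Finset.sum_const,
      Finset.card_erase_of_mem (Finset.mem_univ j), Finset.card_univ, Fintype.card_fin,
      nsmul_eq_mul, Nat.cast_pred j.pos]
    ring
  have hnm : (m : ℝ) < n := by exact_mod_cast hm
  rw [Finset.sum_congr rfl fun i _ => hterm i, hsum] at h
  have h2 : 2 * ((n : ℝ) - m) * D j a = 0 := by
    change ((n : ℝ) - m - 1) * D j a = _ at h
    linarith
  exact (mul_eq_zero.1 h2).resolve_left (by linarith)

/-- The first solution component of the algebraic integrability condition. -/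
theorem eq_neg_contraction_of_integrability (hm : m + 1 < n) (hA : ∀ b, IsAlt (A b))
    (hB : ∀ b, IsAlt (B b))
    (hAB : ∀ (b c : Euc n) (a : Fin (m + 1) → Euc n),
      wedge c (A b) a + B b (cons c a) = wedge b (A c) a + B c (cons b a))
    (b : Euc n) (a : Fin m → Euc n) :
    A b a = -(((n : ℝ) - m - 1)⁻¹ • contraction B) (cons b a) := by
  have hnm : (m : ℝ) + 1 < n := by exact_mod_cast hm
  have h := trace_integrability hA hB hAB b a
  simp only [sum_map_update_basisFun_eq_zero (by omega) hA hB hAB, mul_zero,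
    Finset.sum_const_zero, neg_zero, zero_sub] at h
  rw [smul_apply, smul_eq_mul, ← mul_neg, ← h, inv_mul_cancel_left₀ (by linarith)]

/-- The second solution component of the algebraic integrability condition. -/
theorem eq_wedge_of_integrability {R : FormML n (m + 1)} (hR : IsAlt R) (hB : ∀ b, IsAlt (B b))
    (hAR : ∀ b a, A b a = -R (cons b a))
    (hAB : ∀ (b c : Euc n) (a : Fin (m + 1) → Euc n),
      wedge c (A b) a + B b (cons c a) = wedge b (A c) a + B c (cons b a))
    (b : Euc n) (y : Fin (m + 2) → Euc n) : B b y = wedge b R y := by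
  have hAw : ∀ (b c : Euc n) (z : Fin (m + 1) → Euc n),
      wedge c (A b) z = -∑ i, ⟪c, z i⟫ * R (update z i b) := fun b c z => by
    rw [wedge, ← Finset.sum_neg_distrib]
    refine Finset.sum_congr rfl fun i _ => ?_
    rw [hAR, ← hR.neg_one_pow_mul_map_cons_removeNth]
    ring
  rw [← cons_self_tail y, ← cons_self_tail (tail y)]
  refine sub_eq_zero.1 (eq_zero_of_symm_of_skew
    (fun b c d => B b (cons c (cons d (tail (tail y)) : Fin (m + 1) → Euc n)) -
      wedge b R (cons c (cons d (tail (tail y)) : Fin (m + 1) → Euc n)))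
    (fun b c d => ?_) (fun b c d => ?_) b (y 0) (tail y 0))
  · have h := hAB b c (cons d (tail (tail y)))
    rw [hAw, hAw] at h
    rw [wedge_cons hR, wedge_cons hR, real_inner_comm]
    linarith
  · rw [(hB b).map_cons_cons_swap, wedge_cons_cons_swap hR]
    ring

/-- The integrability condition for the covariant derivative of the last prolongation variable
has only the zero solution. -/
theorem eq_zero_of_wedge_symm {Q : Euc n →L[ℝ] FormML n (m + 1)} (hn : 3 ≤ n)
    (hQ : ∀ b, IsAlt (Q b)) (hsymm : ∀ b c a, Q c (cons b a) = Q b (cons c a))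
    (hwedge : ∀ b c y, wedge b (Q c) y = wedge c (Q b) y) : Q = 0 := by
  ext b y
  rw [← cons_self_tail y]
  cases m with
  | succ m =>
    rw [← cons_self_tail (tail y)]
    exact eq_zero_of_symm_of_skew
      (fun b c d => Q b (cons c (cons d (tail (tail y)) : Fin (m + 1) → Euc n)))
      (fun b c d => hsymm c b _) (fun b c d => (hQ b).map_cons_cons_swap c d _) b (y 0) (tail y 0)
  | zero =>
    set E := EuclideanSpace.basisFun (Fin n) ℝ
    have hn' : (3 : ℝ) ≤ n := by exact_mod_cast hn
    have hw : ∀ (b c x : Euc n) (a : Fin 1 → Euc n),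
        wedge c (Q b) (cons x a) = ⟪c, x⟫ * Q b a - ⟪c, a 0⟫ * Q b (update a 0 x) := fun b c x a => by
      rw [wedge_cons (hQ b), Fin.sum_univ_one]
    have hQb : ∀ (b : Euc n) (a : Fin 1 → Euc n), ∑ e, ⟪b, E e⟫ * Q (E e) a = Q b a := fun b a => by
      simp only [real_inner_comm _ b]
      exact sum_inner_basisFun_mul
        (((ContinuousMultilinearMap.apply ℝ (fun _ : Fin 1 => Euc n) ℝ a).comp Q :
          Euc n →L[ℝ] ℝ) : Euc n →ₗ[ℝ] ℝ) b
    have htrace : ∀ (b : Euc n) (a : Fin 1 → Euc n), ((n : ℝ) - 2) * Q b a =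
        -(⟪b, a 0⟫ * ∑ e, Q (E e) (update a 0 (E e))) := fun b a => by
      have h := Finset.sum_congr (rfl : (Finset.univ : Finset (Fin n)) = _)
        fun e _ => hwedge (E e) b (cons (E e) a)
      rw [sum_wedge_basisFun_cons (hQ b)] at h
      simp only [hw, Finset.sum_sub_distrib, hQb, ← Finset.mul_sum] at h
      push_cast at h
      linarith
    have hupd : ∀ (a : Fin 1 → Euc n) (x : Euc n), update a 0 x = fun _ => x := fun a x => by
      funext i
      rw [Subsingleton.elim i 0, update_self]
    simp only [hupd] at htrace
    have htr : ∑ e, Q (E e) (fun _ => E e) = 0 := by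
      have h := Finset.sum_congr (rfl : (Finset.univ : Finset (Fin n)) = _)
        fun e _ => htrace (E e) (fun _ => E e)
      rw [← Finset.mul_sum] at h
      simp at h
      nlinarith
    have h := htrace b (cons (y 0) (tail y))
    rw [htr, mul_zero, neg_zero] at h
    exact (mul_eq_zero.1 h).resolve_left (by linarith)

end FirstProlongation

end Forms

section Calculus

variable {n m : ℕ} {U : Set (Euc n)} {x : Euc n}

theorem fderiv_clm_apply_form (L : FormML n m →L[ℝ] ℝ) {f : Euc n → FormML n m}
    (hf : DifferentiableAt ℝ f x) (b : Euc n) :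
    fderiv ℝ (fun y => L (f y)) x b = L (fderiv ℝ f x b) :=
  DFunLike.congr_fun (L.hasFDerivAt.comp x hf.hasFDerivAt).fderiv b

theorem fderiv_form_apply {f : Euc n → FormML n m} (hf : DifferentiableAt ℝ f x) (b : Euc n)
    (a : Fin m → Euc n) : fderiv ℝ (fun y => f y a) x b = fderiv ℝ f x b a :=
  fderiv_clm_apply_form (ContinuousMultilinearMap.apply ℝ (fun _ : Fin m => Euc n) ℝ a) hf b

theorem fderiv_wedge {f : Euc n → FormML n m} (hf : DifferentiableAt ℝ f x) (b c : Euc n)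
    (a : Fin (m + 1) → Euc n) :
    fderiv ℝ (fun y => wedge c (f y) a) x b = wedge c (fderiv ℝ f x b) a := by
  simp only [← wedgeCLM_apply]
  exact fderiv_clm_apply_form (wedgeCLM c a) hf b

theorem differentiableAt_form_apply {f : Euc n → FormML n m} (hf : DifferentiableAt ℝ f x)
    (a : Fin m → Euc n) : DifferentiableAt ℝ (fun y => f y a) x :=
  (ContinuousMultilinearMap.apply ℝ (fun _ : Fin m => Euc n) ℝ a).differentiableAt.comp x hf

theorem differentiableAt_wedge {f : Euc n → FormML n m} (hf : DifferentiableAt ℝ f x)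
    (c : Euc n) (a : Fin (m + 1) → Euc n) :
    DifferentiableAt ℝ (fun y => wedge c (f y) a) x := by
  simp only [← wedgeCLM_apply]
  exact (wedgeCLM c a).differentiableAt.comp x hf

theorem ContDiffOn.differentiableAt_of_isOpen {F : Type*} [NormedAddCommGroup F]
    [NormedSpace ℝ F] {f : Euc n → F} (hf : ContDiffOn ℝ (⊤ : ℕ∞) f U) (hU : IsOpen U)
    (hx : x ∈ U) : DifferentiableAt ℝ f x :=
  (hf.contDiffAt (hU.mem_nhds hx)).differentiableAt (by simp)

theorem ContDiffOn.fderiv_infty {F : Type*} [NormedAddCommGroup F]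
    [NormedSpace ℝ F] {f : Euc n → F} (hf : ContDiffOn ℝ (⊤ : ℕ∞) f U) (hU : IsOpen U) :
    ContDiffOn ℝ (⊤ : ℕ∞) (fderiv ℝ f) U :=
  hf.fderiv_of_isOpen hU (by simp)

theorem isAlt_fderiv (hU : IsOpen U) {f : Euc n → FormML n m}
    (hf : ContDiffOn ℝ (⊤ : ℕ∞) f U) (halt : ∀ y ∈ U, IsAlt (f y)) (hx : x ∈ U) (b : Euc n) :
    IsAlt (fderiv ℝ f x b) := fun v i j hij h => by
  have hzero : (fun y => f y v) =ᶠ[nhds x] fun _ => 0 := by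
    filter_upwards [hU.mem_nhds hx] with y hy using halt y hy v i j hij h
  rw [← fderiv_form_apply (hf.differentiableAt_of_isOpen hU hx), hzero.fderiv_eq]
  simp

/-- Evaluating a second derivative from a pointwise formula for the first one. -/
theorem fderiv_fderiv_form_apply (hU : IsOpen U) {f : Euc n → FormML n m}
    (hf : ContDiffOn ℝ (⊤ : ℕ∞) f U) (hx : x ∈ U) {c : Euc n} {a : Fin m → Euc n}
    {g : Euc n → ℝ} (hg : ∀ y ∈ U, fderiv ℝ f y c a = g y) (b : Euc n) :
    fderiv ℝ (fderiv ℝ f) x b c a = fderiv ℝ g x b := by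
  have heq : (fun y => fderiv ℝ f y c a) =ᶠ[nhds x] g := by
    filter_upwards [hU.mem_nhds hx] with y hy using hg y hy
  have hd := (hf.fderiv_infty hU).differentiableAt_of_isOpen hU hx
  rw [← heq.fderiv_eq, fderiv_form_apply (hd.clm_apply (differentiableAt_const c)),
    fderiv_clm_apply hd (differentiableAt_const c)]
  simp

theorem fderiv_fderiv_comm (hU : IsOpen U) {f : Euc n → FormML n m}
    (hf : ContDiffOn ℝ (⊤ : ℕ∞) f U) (hx : x ∈ U) (b c : Euc n) :
    fderiv ℝ (fderiv ℝ f) x b c = fderiv ℝ (fderiv ℝ f) x c b :=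
  ((hf.contDiffAt (hU.mem_nhds hx)).isSymmSndFDerivAt
    (by
      rw [minSmoothness_of_isRCLikeNormedField]
      exact WithTop.coe_le_coe.2 (le_top (a := (2 : ℕ∞))))).eq b c

theorem contDiffOn_contraction {B : Euc n → Euc n →L[ℝ] FormML n (m + 1)}
    (hB : ContDiffOn ℝ (⊤ : ℕ∞) B U) :
    ContDiffOn ℝ (⊤ : ℕ∞) (fun y => contraction (B y)) U := by
  let L : FormML n (m + 1) →L[ℝ] Euc n →L[ℝ] FormML n m :=
    (continuousMultilinearCurryLeftEquiv ℝ (fun _ : Fin (m + 1) => Euc n)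
      ℝ).toContinuousLinearEquiv.toContinuousLinearMap
  have hL : ContDiff ℝ (⊤ : ℕ∞) L := by fun_prop
  exact ContDiffOn.sum fun e _ => ContDiffOn.clm_apply
    (hL.comp_contDiffOn (hB.clm_apply contDiffOn_const)) contDiffOn_const

end Calculus

section Prolongation

variable {n m : ℕ} {U : Set (Euc n)}

theorem sum_omitArg_eq_wedge (c : Euc n) (f : FormML n m) (a : Fin (m + 1) → Euc n) :
    ∑ i : Fin (m + 1), (-1 : ℝ) ^ (i : ℕ) * ⟪c, a i⟫ * f (omitArg i a) = wedge c f a := by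
  simp only [omitArg_eq_removeNth]
  rfl

/-- Solutions of the conformal Killing equation extend to the prolonged system. -/
theorem exists_prolongation (hn : 3 ≤ n) (hm : m + 1 < n) (hU : IsOpen U)
    {σ : Euc n → FormML n (m + 1)} {τ : Euc n → FormML n m} {ρ : Euc n → FormML n (m + 2)}
    (hσ : ContDiffOn ℝ (⊤ : ℕ∞) σ U) (hτ : ContDiffOn ℝ (⊤ : ℕ∞) τ U)
    (hρ : ContDiffOn ℝ (⊤ : ℕ∞) ρ U)
    (hτa : ∀ x ∈ U, IsAlt (τ x)) (hρa : ∀ x ∈ U, IsAlt (ρ x))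
    (h : ∀ x ∈ U, ∀ c a, fderiv ℝ σ x c a = wedge c (τ x) a + ρ x (cons c a)) :
    ∃ R : Euc n → FormML n (m + 1), ContDiffOn ℝ (⊤ : ℕ∞) R U ∧ (∀ x ∈ U, IsAlt (R x)) ∧
      (∀ x ∈ U, ∀ c y, fderiv ℝ ρ x c y = wedge c (R x) y) ∧
      (∀ x ∈ U, ∀ c a, fderiv ℝ τ x c a = -R x (cons c a)) ∧
      ∀ x ∈ U, fderiv ℝ R x = 0 := by
  have hcompat : ∀ x ∈ U, ∀ (b c : Euc n) (a : Fin (m + 1) → Euc n),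
      wedge c (fderiv ℝ τ x b) a + fderiv ℝ ρ x b (cons c a) =
        wedge b (fderiv ℝ τ x c) a + fderiv ℝ ρ x c (cons b a) := fun x hx b c a => by
    have hτd := hτ.differentiableAt_of_isOpen hU hx
    have hρd := hρ.differentiableAt_of_isOpen hU hx
    have hsnd : ∀ b c : Euc n, fderiv ℝ (fderiv ℝ σ) x b c a =
        wedge c (fderiv ℝ τ x b) a + fderiv ℝ ρ x b (cons c a) := fun b c => by
      rw [fderiv_fderiv_form_apply hU hσ hx fun y hy => h y hy c a,
        fderiv_fun_add (differentiableAt_wedge hτd c a) (differentiableAt_form_apply hρd _),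
        add_apply, fderiv_wedge hτd, fderiv_form_apply hρd]
    rw [← hsnd, ← hsnd, fderiv_fderiv_comm hU hσ hx]
  have hDτa := fun x (hx : x ∈ U) => isAlt_fderiv hU hτ hτa hx
  have hDρa := fun x (hx : x ∈ U) => isAlt_fderiv hU hρ hρa hx
  set R : Euc n → FormML n (m + 1) := fun x => ((n : ℝ) - m - 1)⁻¹ • contraction (fderiv ℝ ρ x)
  have hR : ContDiffOn ℝ (⊤ : ℕ∞) R U :=
    (contDiffOn_contraction (hρ.fderiv_infty hU)).const_smul _
  have hRa : ∀ x ∈ U, IsAlt (R x) := fun x hx v i j hij hv => by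
    rw [smul_apply, isAlt_contraction (hDρa x hx) v i j hij hv, smul_zero]
  have hDτ : ∀ x ∈ U, ∀ c a, fderiv ℝ τ x c a = -R x (cons c a) := fun x hx =>
    eq_neg_contraction_of_integrability hm (hDτa x hx) (hDρa x hx) (hcompat x hx)
  have hDρ : ∀ x ∈ U, ∀ c y, fderiv ℝ ρ x c y = wedge c (R x) y := fun x hx =>
    eq_wedge_of_integrability (hRa x hx) (hDρa x hx) (hDτ x hx) (hcompat x hx)
  refine ⟨R, hR, hRa, hDρ, hDτ, fun x hx => ?_⟩
  have hRd := hR.differentiableAt_of_isOpen hU hx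
  refine eq_zero_of_wedge_symm hn (isAlt_fderiv hU hR hRa hx) (fun b c a => ?_) fun b c y => ?_
  · have hsnd : ∀ b c : Euc n, fderiv ℝ (fderiv ℝ τ) x b c a = -fderiv ℝ R x b (cons c a) :=
      fun b c => by
        rw [fderiv_fderiv_form_apply hU hτ hx fun y hy => hDτ y hy c a, fderiv_fun_neg, neg_apply,
          fderiv_form_apply hRd]
    rw [← neg_inj, ← hsnd, ← hsnd, fderiv_fderiv_comm hU hτ hx]
  · have hsnd : ∀ b c : Euc n, fderiv ℝ (fderiv ℝ ρ) x b c y = wedge c (fderiv ℝ R x b) y :=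
      fun b c => by
        rw [fderiv_fderiv_form_apply hU hρ hx fun z hz => hDρ z hz c y, fderiv_wedge hRd]
    rw [← hsnd, ← hsnd, fderiv_fderiv_comm hU hρ hx]

/-- The prolonged system in terms of `Fin.cons` and `wedge`. -/
theorem prolongSys_iff {σ : Euc n → FormML n (m + 1)} {μ : Euc n → FormML n (m + 2)}
    {ν : Euc n → FormML n m} {ρ : Euc n → FormML n (m + 1)} :
    ProlongSys n (m + 1) U σ μ ν ρ ↔
      ContDiffOn ℝ (⊤ : ℕ∞) μ U ∧ ContDiffOn ℝ (⊤ : ℕ∞) ν U ∧ ContDiffOn ℝ (⊤ : ℕ∞) ρ U ∧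
      (∀ x ∈ U, IsAlt (μ x)) ∧ (∀ x ∈ U, IsAlt (ν x)) ∧ (∀ x ∈ U, IsAlt (ρ x)) ∧
      (∀ x ∈ U, ∀ c a, fderiv ℝ σ x c a =
        μ x (cons c a) + (1 / ((m + 1 : ℕ) : ℝ)) * wedge c (ν x) a) ∧
      (∀ x ∈ U, ∀ c b, fderiv ℝ μ x c b = wedge c (ρ x) b) ∧
      (∀ x ∈ U, ∀ c d, fderiv ℝ ν x c d = -((m + 1 : ℕ) : ℝ) * ρ x (cons c d)) ∧
      (∀ x ∈ U, fderiv ℝ ρ x = 0) := by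
  simp only [← sum_omitArg_eq_wedge, ← consCast_eq_cons]
  rfl

/-- The conformal Killing equation in terms of `Fin.cons` and `wedge`. -/
theorem flatCKF_iff {σ : Euc n → FormML n (m + 1)} :
    FlatCKF n (m + 1) U σ ↔
      ContDiffOn ℝ (⊤ : ℕ∞) σ U ∧ (∀ x ∈ U, IsAlt (σ x)) ∧
      ∃ (τ : Euc n → FormML n m) (ρ : Euc n → FormML n (m + 2)),
        ContDiffOn ℝ (⊤ : ℕ∞) τ U ∧ ContDiffOn ℝ (⊤ : ℕ∞) ρ U ∧
        (∀ x ∈ U, IsAlt (τ x)) ∧ (∀ x ∈ U, IsAlt (ρ x)) ∧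
        ∀ x ∈ U, ∀ c a, fderiv ℝ σ x c a = wedge c (τ x) a + ρ x (cons c a) := by
  simp only [← sum_omitArg_eq_wedge, ← consCast_eq_cons]
  rfl

theorem isAlt_smul {f : FormML n m} (hf : IsAlt f) (r : ℝ) : IsAlt (r • f) :=
  fun v i j hij h => by rw [smul_apply, hf v i j hij h, smul_zero]

theorem flatCKF_iff_exists_prolongSys (hn : 3 ≤ n) (hm : m + 1 < n) (hU : IsOpen U)
    {σ : Euc n → FormML n (m + 1)} (hσ : ContDiffOn ℝ (⊤ : ℕ∞) σ U)
    (hσa : ∀ x ∈ U, IsAlt (σ x)) :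
    FlatCKF n (m + 1) U σ ↔ ∃ μ ν ρ, ProlongSys n (m + 1) U σ μ ν ρ := by
  have hm0 : ((m + 1 : ℕ) : ℝ) ≠ 0 := by positivity
  constructor
  · intro h
    obtain ⟨-, -, τ, ρ, hτ, hρ, hτa, hρa, h⟩ := flatCKF_iff.1 h
    obtain ⟨R, hR, hRa, hDρ, hDτ, hDR⟩ := exists_prolongation hn hm hU hσ hτ hρ hτa hρa h
    refine ⟨ρ, fun x => ((m + 1 : ℕ) : ℝ) • τ x, R, prolongSys_iff.2 ⟨hρ, hτ.const_smul _, hR, hρa,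
      fun x hx => isAlt_smul (hτa x hx) _, hRa, fun x hx c a => ?_, hDρ, fun x hx c d => ?_, hDR⟩⟩
    · rw [h x hx, wedge_smul, one_div, inv_mul_cancel_left₀ hm0, add_comm]
    · rw [fderiv_fun_const_smul (hτ.differentiableAt_of_isOpen hU hx), smul_apply, smul_apply,
        hDτ x hx, smul_eq_mul]
      ring
  · rintro ⟨μ, ν, ρ, h⟩
    obtain ⟨hμ, hν, -, hμa, hνa, -, h, -⟩ := prolongSys_iff.1 h
    refine flatCKF_iff.2 ⟨hσ, hσa, fun x => (1 / ((m + 1 : ℕ) : ℝ)) • ν x, μ, hν.const_smul _, hμ,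
      fun x hx => isAlt_smul (hνa x hx) _, hμa, fun x hx c a => ?_⟩
    rw [h x hx, wedge_smul, add_comm]

theorem ProlongSys.unique (hm : m + 1 < n) (hU : IsOpen U)
    {σ : Euc n → FormML n (m + 1)} {μ μ' : Euc n → FormML n (m + 2)}
    {ν ν' : Euc n → FormML n m} {ρ ρ' : Euc n → FormML n (m + 1)}
    (h : ProlongSys n (m + 1) U σ μ ν ρ) (h' : ProlongSys n (m + 1) U σ μ' ν' ρ')
    {x : Euc n} (hx : x ∈ U) : μ x = μ' x ∧ ν x = ν' x ∧ ρ x = ρ' x := by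
  have hm0 : ((m + 1 : ℕ) : ℝ) ≠ 0 := by positivity
  obtain ⟨-, -, -, hμa, hνa, -, h1, -, h3, -⟩ := prolongSys_iff.1 h
  obtain ⟨-, -, -, hμa', hνa', -, h1', -, h3', -⟩ := prolongSys_iff.1 h'
  have hν : ∀ y ∈ U, ν y = ν' y := fun y hy => by
    refine sub_eq_zero.1 (eq_zero_of_wedge_basisFun_eq_zero (fun v i j hij hv => ?_)
      (by omega : m < n) fun c a => ?_)
    · rw [sub_apply, hνa y hy v i j hij hv, hνa' y hy v i j hij hv, sub_zero]
    · have heq := (h1 y hy c (cons c a)).symm.trans (h1' y hy c (cons c a))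
      have hz : ∀ f : FormML n (m + 2), IsAlt f →
          f (cons c (cons c a : Fin (m + 1) → Euc n)) = 0 := fun f hf => hf _ 0 1 (by simp) rfl
      rw [hz _ (hμa y hy), hz _ (hμa' y hy), zero_add, zero_add] at heq
      rw [wedge_sub, mul_left_cancel₀ (one_div_ne_zero hm0) heq, sub_self]
  refine ⟨?_, hν x hx, ?_⟩
  · ext y
    have heq := (h1 x hx (y 0) (tail y)).symm.trans (h1' x hx (y 0) (tail y))
    rw [hν x hx, cons_self_tail] at heq
    exact add_right_cancel heq
  · have hD : fderiv ℝ ν x = fderiv ℝ ν' x := by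
      refine Filter.EventuallyEq.fderiv_eq ?_
      filter_upwards [hU.mem_nhds hx] with y hy using hν y hy
    ext y
    have heq := h3 x hx (y 0) (tail y)
    rw [hD, h3' x hx, cons_self_tail] at heq
    exact (mul_left_cancel₀ (neg_ne_zero.2 hm0) heq).symm

end Prolongation

/-- For `n ≥ 3`, `1 ≤ k ≤ n-1` and `U ⊆ ℝⁿ` open, a smooth `k`-form `σ`
on `U` satisfies the flat conformal Killing equation iff it extends to a solution
`(σ, μ, ν, ρ)` of the closed prolonged system; moreover `μ, ν, ρ` are then unique. -/
theorem flat_conformal_killing_prolongation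
    (n k : ℕ) (hn : 3 ≤ n) (hk1 : 1 ≤ k) (hkn : k ≤ n - 1)
    (U : Set (Euc n)) (hU : IsOpen U)
    (σ : Euc n → FormML n k) (hσsmooth : ContDiffOn ℝ (⊤ : ℕ∞) σ U)
    (hσalt : ∀ x ∈ U, IsAlt (σ x)) :
    (FlatCKF n k U σ ↔ ∃ μ ν ρ, ProlongSys n k U σ μ ν ρ) ∧
    (∀ μ ν ρ μ' ν' ρ', ProlongSys n k U σ μ ν ρ → ProlongSys n k U σ μ' ν' ρ' →
      ∀ x ∈ U, μ x = μ' x ∧ ν x = ν' x ∧ ρ x = ρ' x) := by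
  obtain ⟨m, rfl⟩ : ∃ m, k = m + 1 := ⟨k - 1, by omega⟩
  exact ⟨flatCKF_iff_exists_prolongSys hn (by omega) hU hσsmooth hσalt,
    fun _ _ _ _ _ _ h h' _ hx => ProlongSys.unique (by omega) hU h h' hx⟩
end
end

section
/- Let n ≥ 3, let 1 ≤ k ≤ n−1, and let U ⊆ ℝⁿ be a nonempty connected open set. If a smooth map σ from U to k-forms satisfies the flat conformal Killing equation and σ vanishes identically on some nonempty open subset of U, then σ vanishes identically on U. Equivalently, a flat conformal Killing k-form on U that is not identically zero is nonvanishing on a dense open subset of U. -/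
open scoped RealInnerProductSpace BigOperators

noncomputable section

/-- The `i`-th partial derivative of a scalar function on `ℝⁿ`. -/
def partialD {n : ℕ} (i : Fin n) (f : Euc n → ℝ) (x : Euc n) : ℝ :=
  fderiv ℝ f x (EuclideanSpace.single i 1)

section PartialDerivatives

variable {n : ℕ} {U : Set (Euc n)} {f g : Euc n → ℝ}

lemma contDiffOn_partialD (hU : IsOpen U) (hf : ContDiffOn ℝ (⊤ : ℕ∞) f U) (i : Fin n) :
    ContDiffOn ℝ (⊤ : ℕ∞) (partialD i f) U :=
  (hf.fderiv_of_isOpen hU (by simp)).clm_apply contDiffOn_const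

lemma partialD_congr (hU : IsOpen U) (h : Set.EqOn f g U) (i : Fin n) :
    Set.EqOn (partialD i f) (partialD i g) U := fun x hx => by
  have : f =ᶠ[nhds x] g := Filter.eventuallyEq_of_mem (hU.mem_nhds hx) h
  simp only [partialD, this.fderiv_eq]

lemma partialD_neg (i : Fin n) : partialD i (-f) = -partialD i f := by
  ext x
  simp [partialD, fderiv_neg]

lemma partialD_zero (i : Fin n) : partialD i (0 : Euc n → ℝ) = 0 := by
  ext x
  simp [partialD]

lemma partialD_comm (hU : IsOpen U) (hf : ContDiffOn ℝ (⊤ : ℕ∞) f U) (i j : Fin n) :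
    Set.EqOn (partialD i (partialD j f)) (partialD j (partialD i f)) U := fun x hx => by
  have hfx : ContDiffAt ℝ (⊤ : ℕ∞) f x := hf.contDiffAt (hU.mem_nhds hx)
  have hd : DifferentiableAt ℝ (fderiv ℝ f) x :=
    ((hf.fderiv_of_isOpen (m := (⊤ : ℕ∞)) hU (by simp)).contDiffAt
      (hU.mem_nhds hx)).differentiableAt (by simp)
  have key (u v : Euc n) : fderiv ℝ (fun y => fderiv ℝ f y u) x v = fderiv ℝ (fderiv ℝ f) x v u := by
    rw [fderiv_clm_apply hd (differentiableAt_const u)]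
    simp
  have hs : IsSymmSndFDerivAt ℝ f x := hfx.isSymmSndFDerivAt (by simpa using WithTop.coe_le_coe.2 (le_top (a := (2 : ℕ∞))))
  change fderiv ℝ (fun y => fderiv ℝ f y _) x _ = fderiv ℝ (fun y => fderiv ℝ f y _) x _
  rw [key, key]
  exact hs _ _

/-- A function on a connected open set whose partial derivatives all vanish, and which vanishes
at some point, is zero. -/
lemma eqOn_zero_of_partialD_eq_zero (hU : IsOpen U) (hUc : IsPreconnected U)
    (hf : ContDiffOn ℝ (⊤ : ℕ∞) f U) (h : ∀ i, Set.EqOn (partialD i f) 0 U)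
    {y : Euc n} (hy : y ∈ U) (hfy : f y = 0) : Set.EqOn f 0 U := by
  have hd : Set.EqOn (fderiv ℝ f) 0 U := fun x hx => by
    have : (fderiv ℝ f x : Euc n →ₗ[ℝ] ℝ) = 0 :=
      (EuclideanSpace.basisFun (Fin n) ℝ).toBasis.ext fun i => by
        simpa [partialD] using h i hx
    ext v
    exact LinearMap.congr_fun this v
  intro x hx
  have := hU.is_const_of_fderiv_eq_zero hUc (hf.differentiableOn (by simp)) hd hx hy
  simpa [hfy] using this

/-- Unique continuation for functions annihilated by all third pure partial derivatives. -/
lemma eqOn_zero_of_partialD_cube_eq_zero (hU : IsOpen U) (hUc : IsPreconnected U)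
    {V : Set (Euc n)} (hV : IsOpen V) (hVne : V.Nonempty) (hVU : V ⊆ U)
    (hf : ContDiffOn ℝ (⊤ : ℕ∞) f U)
    (h : ∀ i, Set.EqOn (partialD i (partialD i (partialD i f))) 0 U)
    (hfV : Set.EqOn f 0 V) : Set.EqOn f 0 U := by
  suffices H : ∀ m : ℕ, ∀ f : Euc n → ℝ, ContDiffOn ℝ (⊤ : ℕ∞) f U →
      (∀ i, Set.EqOn (partialD i (partialD i (partialD i f))) 0 U) →
      (∀ i : Fin n, m ≤ i → Set.EqOn (partialD i f) 0 U) → Set.EqOn f 0 V → Set.EqOn f 0 U from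
    H n f hf h (fun i hi => absurd i.isLt (by omega)) hfV
  have zero (i : Fin n) {W : Set (Euc n)} (hW : IsOpen W) {g : Euc n → ℝ}
      (hg : Set.EqOn g 0 W) : Set.EqOn (partialD i g) 0 W := by
    simpa only [partialD_zero] using partialD_congr hW hg i
  intro m
  induction m with
  | zero =>
    intro f hf _ h1 hfV
    obtain ⟨y, hy⟩ := hVne
    exact eqOn_zero_of_partialD_eq_zero hU hUc hf (fun i => h1 i (Nat.zero_le _)) (hVU hy) (hfV hy)
  | succ m ih =>
    intro f hf h3 h1 hfV
    by_cases hm : m < n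
    swap
    · exact ih f hf h3 (fun i hi => absurd i.isLt (by omega)) hfV
    let j : Fin n := ⟨m, hm⟩
    have reduce (g : Euc n → ℝ) (hg : ContDiffOn ℝ (⊤ : ℕ∞) g U)
        (g3 : ∀ i, Set.EqOn (partialD i (partialD i (partialD i g))) 0 U)
        (g1 : ∀ i : Fin n, m + 1 ≤ i → Set.EqOn (partialD i g) 0 U)
        (gj : Set.EqOn (partialD j g) 0 U) (gV : Set.EqOn g 0 V) : Set.EqOn g 0 U := by
      refine ih g hg g3 (fun i hi => ?_) gV
      rcases hi.eq_or_lt with hi | hi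
      · rwa [show i = j from Fin.ext hi.symm]
      · exact g1 i hi
    have deriv3 (g : Euc n → ℝ) (hg : ContDiffOn ℝ (⊤ : ℕ∞) g U)
        (g3 : ∀ i, Set.EqOn (partialD i (partialD i (partialD i g))) 0 U) (i : Fin n) :
        Set.EqOn (partialD i (partialD i (partialD i (partialD j g)))) 0 U := by
      have e1 := partialD_congr hU (partialD_congr hU (partialD_comm hU hg i j) i) i
      have e2 := partialD_congr hU (partialD_comm hU (contDiffOn_partialD hU hg i) i j) i
      have e3 := partialD_comm hU (contDiffOn_partialD hU (contDiffOn_partialD hU hg i) i) i j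
      exact ((e1.trans e2).trans e3).trans (zero j hU (g3 i))
    have deriv1 (g : Euc n → ℝ) (hg : ContDiffOn ℝ (⊤ : ℕ∞) g U)
        (g1 : ∀ i : Fin n, m + 1 ≤ i → Set.EqOn (partialD i g) 0 U) (i : Fin n)
        (hi : m + 1 ≤ i) : Set.EqOn (partialD i (partialD j g)) 0 U :=
      (partialD_comm hU hg i j).trans (zero j hU (g1 i hi))
    have s1 := contDiffOn_partialD hU hf j
    have s2 := contDiffOn_partialD hU s1 j
    have v1 := zero j hV hfV
    have v2 := zero j hV v1
    have z2 := reduce _ s2 (deriv3 _ s1 (deriv3 _ hf h3)) (deriv1 _ s1 (deriv1 _ hf h1)) (h3 j) v2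
    have z1 := reduce _ s1 (deriv3 _ hf h3) (deriv1 _ hf h1) z2 v1
    exact reduce f hf h3 h1 z1 hfV

end PartialDerivatives

/-- Third-order consequence of the conformal Killing equations
`∂ᵢf = ∂ⱼg = ∂ₗh`, `∂ᵢg = -∂ⱼf`, `∂ᵢh = -∂ₗf`, `∂ⱼh = -∂ₗg` for a vector field `(f, g, h)`
in three variables, where `f u v w` stands for the third partial derivative `∂ᵤ∂ᵥ∂_w f`. -/
lemma conformal_triple_cube_eq_zero {ι : Type*} {f g h : ι → ι → ι → ℝ} {i j l : ι}
    (f₁ : ∀ u v w, f u v w = f v u w) (f₂ : ∀ u v w, f u v w = f u w v)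
    (g₁ : ∀ u v w, g u v w = g v u w) (g₂ : ∀ u v w, g u v w = g u w v)
    (h₁ : ∀ u v w, h u v w = h v u w) (h₂ : ∀ u v w, h u v w = h u w v)
    (fg : ∀ u v, f u v i = g u v j) (gh : ∀ u v, g u v j = h u v l)
    (gf : ∀ u v, g u v i = -f u v j) (hf : ∀ u v, h u v i = -f u v l)
    (hg : ∀ u v, h u v j = -g u v l) : f i i i = 0 ∧ g i i i = 0 := by
  constructor
  · linarith [fg i i, g₂ i i j, gf i j, f₁ i j j, f₂ j i j, gh i i, h₂ i i l, hf i l, f₁ i l l,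
      f₂ l i l, fg j j, gh j j, h₂ j j l, hg j l, g₁ j l l, g₂ l j l, fg l l]
  · linarith [gf i i, f₂ i i j, fg i j, gh i j, h₁ i j l, h₂ j i l, hf j l, f₁ j l l, f₂ l j l,
      gf l l, g₂ l l i, g₁ l i l, hg i l, h₂ i l j]

/-- The symbol-level conformal Killing equations for `k`-forms: `t a u v w` plays the role of
`∂ᵤ∂ᵥ∂_w` of the component with multi-index `a`. -/
lemma conformal_form_cube_eq_zero {n k : ℕ} (hn : 3 ≤ n) (hk1 : 1 ≤ k) (hkn : k ≤ n - 1)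
    {t : (Fin k → Fin n) → Fin n → Fin n → Fin n → ℝ}
    (t₁ : ∀ a u v w, t a u v w = t a v u w) (t₂ : ∀ a u v w, t a u v w = t a u w v)
    (tdiag : ∀ a p d d' u v, (∀ j, j ≠ p → a j ≠ d) → (∀ j, j ≠ p → a j ≠ d') →
      t (Function.update a p d) u v d = t (Function.update a p d') u v d')
    (toff : ∀ a p d d' u v, d ≠ d' → (∀ j, j ≠ p → a j ≠ d) → (∀ j, j ≠ p → a j ≠ d') →
      t (Function.update a p d') u v d = -t (Function.update a p d) u v d')
    (tswap : ∀ a p q u v w, p ≠ q → t (a ∘ Equiv.swap p q) u v w = -t a u v w)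
    {a : Fin k → Fin n} (ha : Function.Injective a) (i : Fin n) : t a i i i = 0 := by
  have hane (p : Fin k) : ∀ j, j ≠ p → a j ≠ a p := fun j hj h => hj (ha h)
  have hcard : (Finset.univ.image a).card = k := by
    rw [Finset.card_image_of_injective _ ha, Finset.card_fin]
  have avoid (s : Finset (Fin n)) (hs : s.card < n) : ∃ c, c ∉ s := by
    by_contra! h
    have : s = Finset.univ := Finset.eq_univ_iff_forall.2 h
    simp [this] at hs
  have triple (p : Fin k) (i j l : Fin n) (hij : i ≠ j) (hil : i ≠ l) (hjl : j ≠ l)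
      (hi : ∀ q, q ≠ p → a q ≠ i) (hj : ∀ q, q ≠ p → a q ≠ j) (hl : ∀ q, q ≠ p → a q ≠ l) :=
    conformal_triple_cube_eq_zero (f := t (Function.update a p i)) (g := t (Function.update a p j))
      (h := t (Function.update a p l)) (i := i) (j := j) (l := l) (t₁ _) (t₂ _) (t₁ _) (t₂ _)
      (t₁ _) (t₂ _) (fun u v => tdiag a p i j u v hi hj) (fun u v => tdiag a p j l u v hj hl)
      (fun u v => toff a p i j u v hij hi hj) (fun u v => toff a p i l u v hil hi hl)
      (fun u v => toff a p j l u v hjl hj hl)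
  by_cases hk : k + 2 ≤ n
  · by_cases hi : ∃ p, a p = i
    · obtain ⟨p, rfl⟩ := hi
      obtain ⟨c, hc⟩ := avoid (Finset.univ.image a) (by omega)
      obtain ⟨d, hd⟩ := avoid (insert c (Finset.univ.image a))
        ((Finset.card_insert_le _ _).trans_lt (by omega))
      simp only [Finset.mem_insert, Finset.mem_image, Finset.mem_univ, true_and, not_or,
        not_exists] at hc hd
      simpa using (triple p (a p) c d (hc p) (hd.2 p) (Ne.symm hd.1) (hane p)
        (fun q _ => hc q) (fun q _ => hd.2 q)).1
    · push Not at hi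
      obtain ⟨d, hd⟩ := avoid (insert i (Finset.univ.image a))
        ((Finset.card_insert_le _ _).trans_lt (by omega))
      simp only [Finset.mem_insert, Finset.mem_image, Finset.mem_univ, true_and, not_or,
        not_exists] at hd
      let p : Fin k := ⟨0, by omega⟩
      simpa using (triple p i (a p) d (hi p).symm (Ne.symm hd.1) (hd.2 p) (fun q _ => hi q)
        (hane p) (fun q _ => hd.2 q)).2
  · -- The Hodge-dual triple, in which two slots `p`, `q` of `a` are exchanged against `c`.
    have dual (p q : Fin k) (c : Fin n) (hpq : p ≠ q) (hc : ∀ r, a r ≠ c) :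
        (∀ u v, t a u v c = -t (Function.update a p c) u v (a p)) ∧
        (∀ u v, -t (Function.update a p c) u v c = -t a u v (a p)) ∧
        (∀ u v, t (Function.update a q c) u v (a p) = -t (Function.update a p c) u v (a q)) := by
      refine ⟨fun u v => ?_, fun u v => ?_, fun u v => ?_⟩
      · simpa using toff a p c (a p) u v (hc p).symm (fun r _ => hc r) (hane p)
      · simpa using tdiag a p c (a p) u v (fun r _ => hc r) (hane p)
      · have hp : ∀ r, r ≠ p → Function.update a q c r ≠ a p := fun r hr => by
          by_cases h : r = q
          · subst h; simpa using (hc p).symm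
          · simpa [h] using hane p r hr
        have hq : ∀ r, r ≠ p → Function.update a q c r ≠ a q := fun r hr => by
          by_cases h : r = q
          · subst h; simpa using (hc r).symm
          · simpa [h] using hane q r h
        have e := tdiag (Function.update a q c) p (a p) (a q) u v hp hq
        rw [show Function.update (Function.update a q c) p (a p) = Function.update a q c by
            rw [Function.update_comm hpq.symm, Function.update_eq_self],
          show Function.update (Function.update a q c) p (a q)
            = Function.update a p c ∘ Equiv.swap p q by
            funext r
            by_cases h1 : r = p
            · subst h1; simp [hpq.symm]
            · by_cases h2 : r = q
              · subst h2; simp [h1]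
              · simp [h1, h2, Equiv.swap_apply_of_ne_of_ne], tswap _ _ _ _ _ _ hpq] at e
        exact e
    have result (p q : Fin k) (c : Fin n) (hpq : p ≠ q) (hc : ∀ r, a r ≠ c) :
        t a c c c = 0 ∧ t a (a p) (a p) (a p) = 0 := by
      obtain ⟨d1, d2, d3⟩ := dual p q c hpq hc
      obtain ⟨d4, d5, -⟩ := dual q p c hpq.symm hc
      have n₁ (b) (u v w) : -t b u v w = -t b v u w := congrArg _ (t₁ b u v w)
      have n₂ (b) (u v w) : -t b u v w = -t b u w v := congrArg _ (t₂ b u v w)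
      constructor
      · exact (conformal_triple_cube_eq_zero (f := t a)
          (g := fun u v w => -t (Function.update a p c) u v w)
          (h := fun u v w => -t (Function.update a q c) u v w) (i := c) (j := a p) (l := a q)
          (t₁ _) (t₂ _) (n₁ _) (n₂ _) (n₁ _) (n₂ _) d1
          (fun u v => (d1 u v).symm.trans (d4 u v)) d2 d5
          (fun u v => by simp only [d3 u v])).1
      · exact (conformal_triple_cube_eq_zero
          (f := fun u v w => -t (Function.update a p c) u v w) (g := t a)
          (h := fun u v w => -t (Function.update a q c) u v w) (i := a p) (j := c) (l := a q)
          (n₁ _) (n₂ _) (t₁ _) (t₂ _) (n₁ _) (n₂ _) (fun u v => (d1 u v).symm) d4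
          (fun u v => by linarith [d2 u v]) (fun u v => by simp only [d3 u v]) d5).2
    obtain ⟨c, hc⟩ := avoid (Finset.univ.image a) (by omega)
    simp only [Finset.mem_image, Finset.mem_univ, true_and, not_exists] at hc
    by_cases hi : ∃ p, a p = i
    · obtain ⟨p, rfl⟩ := hi
      have : Nontrivial (Fin k) := Fin.nontrivial_iff_two_le.2 (by omega)
      obtain ⟨q, hq⟩ := exists_ne p
      exact (result p q c hq.symm hc).2
    · push Not at hi
      exact (result ⟨0, by omega⟩ ⟨1, by omega⟩ i (by simp) hi).1

/-- An alternating continuous multilinear map changes sign when two arguments are exchanged. -/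
lemma IsAlt.comp_swap {n k : ℕ} {f : FormML n k} (hf : IsAlt f) (v : Fin k → Euc n)
    {p q : Fin k} (hpq : p ≠ q) : f (v ∘ Equiv.swap p q) = -f v := by
  let g : Euc n [⋀^Fin k]→ₗ[ℝ] ℝ :=
    { f.toMultilinearMap with map_eq_zero_of_eq' := fun v i j h hij => hf v i j hij h }
  exact g.map_swap v hpq

lemma IsAlt.consCast_update {n k : ℕ} {f : FormML n (k + 1)} (hf : IsAlt f)
    (v : Fin k → Euc n) (p : Fin k) (c d : Euc n) :
    f (consCast c (Function.update v p d)) = -f (consCast d (Function.update v p c)) := by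
  rw [← hf.comp_swap _ (Fin.succ_ne_zero p).symm]
  congr 1
  funext j
  refine Fin.cases ?_ (fun j => ?_) j
  · simp [consCast]
  · by_cases hj : j = p
    · subst hj; simp [consCast]
    · rw [Function.comp_apply, Equiv.swap_apply_of_ne_of_ne (Fin.succ_ne_zero j)
        (fun h => hj (Fin.succ_injective _ h))]
      simp [consCast, hj]

lemma omitArg_update {X : Type*} {k : ℕ} (p : Fin k) (v : Fin k → X) (c : X) :
    omitArg p (Function.update v p c) = omitArg p v := by
  funext j
  unfold omitArg
  split_ifs with h
  · exact Function.update_of_ne (fun e => by rw [Fin.ext_iff] at e; simp at e; omega) _ _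
  · exact Function.update_of_ne (fun e => by rw [Fin.ext_iff] at e; simp at e; omega) _ _

/-- The component of a form-valued map with multi-index `a` in the standard basis. -/
def component {n k : ℕ} (σ : Euc n → FormML n k) (a : Fin k → Fin n) (x : Euc n) : ℝ :=
  σ x fun j => EuclideanSpace.single (a j) 1

section Components

variable {n k : ℕ} {U : Set (Euc n)} {σ : Euc n → FormML n k}

lemma contDiffOn_component (hσ : ContDiffOn ℝ (⊤ : ℕ∞) σ U) (a : Fin k → Fin n) :
    ContDiffOn ℝ (⊤ : ℕ∞) (component σ a) U :=
  (ContinuousMultilinearMap.apply ℝ (fun _ : Fin k => Euc n) ℝ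
    fun j => EuclideanSpace.single (a j) 1).contDiff.comp_contDiffOn hσ

lemma partialD_component {x : Euc n} (hσ : DifferentiableAt ℝ σ x) (a : Fin k → Fin n)
    (i : Fin n) : partialD i (component σ a) x =
      (fderiv ℝ σ x (EuclideanSpace.single i 1)) fun j => EuclideanSpace.single (a j) 1 := by
  have := (ContinuousMultilinearMap.apply ℝ (fun _ : Fin k => Euc n) ℝ
    fun j => EuclideanSpace.single (a j) 1).hasFDerivAt.comp x hσ.hasFDerivAt
  exact DFunLike.congr_fun this.fderiv _

lemma eq_zero_of_component_eq_zero {x : Euc n} (h : ∀ a, component σ a x = 0) : σ x = 0 := by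
  have : (σ x).toMultilinearMap = 0 :=
    Module.Basis.ext_multilinear (fun _ => (EuclideanSpace.basisFun (Fin n) ℝ).toBasis)
      fun a => by simpa [component] using h a
  ext v
  exact DFunLike.congr_fun this v

/-- The conformal Killing equation on components: diagonal and off-diagonal parts. -/
lemma FlatCKF.partialD_component_update (hU : IsOpen U) (hσ : FlatCKF n k U σ)
    (a : Fin k → Fin n) (p : Fin k) {d d' : Fin n} (hd : ∀ j, j ≠ p → a j ≠ d)
    (hd' : ∀ j, j ≠ p → a j ≠ d') :
    Set.EqOn (partialD d (component σ (Function.update a p d)))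
        (partialD d' (component σ (Function.update a p d'))) U ∧
      (d ≠ d' → Set.EqOn (partialD d (component σ (Function.update a p d')))
        (-partialD d' (component σ (Function.update a p d))) U) := by
  obtain ⟨hs, -, τ, ρ, -, -, -, hρ, heq⟩ := hσ
  let e : Fin n → Euc n := fun i => EuclideanSpace.single i 1
  have main (x) (hx : x ∈ U) (c b : Fin n) (hc : ∀ j, j ≠ p → a j ≠ c) :
      partialD c (component σ (Function.update a p b)) x =
        (if c = b then (-1 : ℝ) ^ (p : ℕ) * τ x (omitArg p (e ∘ a)) else 0) +
        ρ x (consCast (e c) (Function.update (e ∘ a) p (e b))) := by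
    have hcomp : (fun j => EuclideanSpace.single (Function.update a p b j) (1 : ℝ))
        = Function.update (e ∘ a) p (e b) := Function.comp_update e a p b
    rw [partialD_component ((hs.contDiffAt (hU.mem_nhds hx)).differentiableAt (by simp)),
      hcomp, heq x hx, Finset.sum_eq_single p]
    · rw [omitArg_update]
      by_cases h : c = b <;> simp [e, h, EuclideanSpace.inner_single_left]
    · intro j _ hj
      simp [e, hj, EuclideanSpace.inner_single_left, (hc j hj).symm]
    · simp
  have self (x) (hx : x ∈ U) (c : Fin n) :
      ρ x (consCast (e c) (Function.update (e ∘ a) p (e c))) = 0 :=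
    self_eq_neg.1 ((hρ x hx).consCast_update _ p (e c) (e c))
  refine ⟨fun x hx => ?_, fun hne x hx => ?_⟩
  · rw [main x hx d d hd, main x hx d' d' hd', self x hx, self x hx]
    simp
  · rw [Pi.neg_apply, main x hx d d' hd, main x hx d' d hd', if_neg hne, if_neg hne.symm,
      (hρ x hx).consCast_update]
    simp

lemma FlatCKF.partialD_cube_component_eq_zero (hn : 3 ≤ n) (hk1 : 1 ≤ k) (hkn : k ≤ n - 1)
    (hU : IsOpen U) (hσ : FlatCKF n k U σ) {a : Fin k → Fin n} (ha : Function.Injective a)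
    (i : Fin n) : Set.EqOn (partialD i (partialD i (partialD i (component σ a)))) 0 U := by
  intro x hx
  have smooth := contDiffOn_component hσ.1
  refine conformal_form_cube_eq_zero hn hk1 hkn
    (t := fun a u v w => partialD u (partialD v (partialD w (component σ a))) x)
    (fun b u v w => partialD_comm hU (contDiffOn_partialD hU (smooth b) w) u v hx)
    (fun b u v w => partialD_congr hU (partialD_comm hU (smooth b) v w) u hx)
    (fun b p d d' u v hd hd' => partialD_congr hU (partialD_congr hU
      (hσ.partialD_component_update hU b p hd hd').1 v) u hx)
    (fun b p d d' u v hne hd hd' => ?_) (fun b p q u v w hpq => ?_) ha i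
  · have := partialD_congr hU (partialD_congr hU
      ((hσ.partialD_component_update hU b p hd hd').2 hne) v) u hx
    simpa only [partialD_neg, Pi.neg_apply] using this
  · have h : Set.EqOn (component σ (b ∘ Equiv.swap p q)) (-component σ b) U :=
      fun y hy => (hσ.2.1 y hy).comp_swap (fun j => EuclideanSpace.single (b j) 1) hpq
    have := partialD_congr hU (partialD_congr hU (partialD_congr hU h w) v) u hx
    simpa only [partialD_neg, Pi.neg_apply] using this

end Components

/-- On a nonempty connected open `U ⊆ ℝⁿ` a flat conformal Killing
`k`-form vanishing on some nonempty open subset vanishes identically; equivalently,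
a not-identically-zero flat conformal Killing form is nonvanishing on a dense open
subset of `U`. -/
theorem flat_conformal_killing_unique_continuation
    (n k : ℕ) (hn : 3 ≤ n) (hk1 : 1 ≤ k) (hkn : k ≤ n - 1)
    (U : Set (Euc n)) (hU : IsOpen U) (hUne : U.Nonempty) (hUconn : IsConnected U)
    (σ : Euc n → FormML n k) (hσ : FlatCKF n k U σ) :
    (∀ V : Set (Euc n), IsOpen V → V.Nonempty → V ⊆ U →
      (∀ x ∈ V, σ x = 0) → ∀ x ∈ U, σ x = 0) ∧
    ((∃ x ∈ U, σ x ≠ 0) →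
      IsOpen {x | x ∈ U ∧ σ x ≠ 0} ∧ U ⊆ closure {x | x ∈ U ∧ σ x ≠ 0}) := by
  have vanish : ∀ V : Set (Euc n), IsOpen V → V.Nonempty → V ⊆ U →
      (∀ x ∈ V, σ x = 0) → ∀ x ∈ U, σ x = 0 := by
    intro V hV hVne hVU h0 x hx
    refine eq_zero_of_component_eq_zero fun a => ?_
    by_cases ha : Function.Injective a
    · exact eqOn_zero_of_partialD_cube_eq_zero hU hUconn.isPreconnected hV hVne hVU
        (contDiffOn_component hσ.1 a)
        (hσ.partialD_cube_component_eq_zero hn hk1 hkn hU ha)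
        (fun y hy => by simp [component, h0 y hy]) hx
    · obtain ⟨p, q, hpq, hne⟩ := Function.not_injective_iff.1 ha
      exact hσ.2.1 x hx _ p q hne (by rw [hpq])
  refine ⟨vanish, fun ⟨x₀, hx₀, hne⟩ => ⟨?_, fun x hx => ?_⟩⟩
  · exact hσ.1.continuousOn.isOpen_inter_preimage hU isOpen_compl_singleton
  · by_contra hcl
    refine hne (vanish (U ∩ (closure {x | x ∈ U ∧ σ x ≠ 0})ᶜ)
      (hU.inter isClosed_closure.isOpen_compl) ⟨x, hx, hcl⟩ Set.inter_subset_left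
      (fun y hy => ?_) x₀ hx₀)
    by_contra hy0
    exact hy.2 (subset_closure ⟨hy.1, hy0⟩)
end
end

section
/- Let n ≥ 3, let U ⊆ ℝⁿ be open, and let σ be a smooth map from U to 1-forms satisfying the flat conformal Killing equation with k = 1. Define the 2-form μ(x)(b,c) := (1/2)((Dσ(x)b)(c) − (Dσ(x)c)(b)). For any integer p ≥ 1 with 2p+1 ≤ n−1, the (2p+1)-form T(x)(a₀,a₁,…,a_{2p}) := Σ_{π ∈ S_{2p+1}} sgn(π) σ(x)(a_{π(0)}) · μ(x)(a_{π(1)},a_{π(2)}) ⋯ μ(x)(a_{π(2p−1)},a_{π(2p)}) satisfies the flat conformal Killing equation for (2p+1)-forms. (This is the Euclidean instance, where the curvature condition σ_{a⁰}C_{a¹a²c}{}^{d}σ_d = 0 holds automatically, of the corollary producing conformal Killing (2p+1)-forms from a conformal Killing 1-form.) -/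
open scoped RealInnerProductSpace BigOperators

noncomputable section

/-- `μ(x)(b,c) = ½((Dσ(x)b)(c) − (Dσ(x)c)(b))`, the 2-form part of the derivative of a
1-form `σ`. -/
def muTwo (n : ℕ) (σ : Euc n → FormML n 1) (y b c : Euc n) : ℝ :=
  (1 / 2) * ((fderiv ℝ σ y b) ![c] - (fderiv ℝ σ y c) ![b])

/-- `T(x)(a₀,…,a_{2p}) = Σ_{π ∈ S_{2p+1}} sgn(π) σ(x)(a_{π(0)}) μ(x)(a_{π(1)},a_{π(2)})
⋯ μ(x)(a_{π(2p-1)},a_{π(2p)})`, the alternated product `σ ∧ μ ∧ ⋯ ∧ μ`. -/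
def sigmaMuPow (n p : ℕ) (σ : Euc n → FormML n 1) (y : Euc n)
    (a : Fin (2 * p + 1) → Euc n) : ℝ :=
  ∑ π : Equiv.Perm (Fin (2 * p + 1)),
    ((Equiv.Perm.sign π : ℤ) : ℝ) *
      (σ y ![a (π 0)] *
        ∏ j : Fin p,
          muTwo n σ y
            (a (π ⟨2 * (j : ℕ) + 1, by have := j.isLt; omega⟩))
            (a (π ⟨2 * (j : ℕ) + 2, by have := j.isLt; omega⟩)))

/-- The permutation of `Fin (m + 1)` fixing `0` and acting as `π` on the successors. -/
def liftPerm {m : ℕ} (π : Equiv.Perm (Fin m)) : Equiv.Perm (Fin (m + 1)) :=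
  Equiv.Perm.decomposeFin.symm (0, π)

@[simp] lemma liftPerm_zero {m : ℕ} (π : Equiv.Perm (Fin m)) : liftPerm π 0 = 0 := by
  simp [liftPerm]

@[simp] lemma liftPerm_succ {m : ℕ} (π : Equiv.Perm (Fin m)) (j : Fin m) :
    liftPerm π j.succ = (π j).succ := by
  simp [liftPerm, Equiv.Perm.decomposeFin_symm_apply_succ]

@[simp] lemma sign_liftPerm {m : ℕ} (π : Equiv.Perm (Fin m)) :
    Equiv.Perm.sign (liftPerm π) = Equiv.Perm.sign π := by
  simp [liftPerm]

/-- The sign of a permutation as a real number. -/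
abbrev rsign {m : ℕ} (π : Equiv.Perm (Fin m)) : ℝ := ((Equiv.Perm.sign π : ℤ) : ℝ)

lemma sum_perm_mul_swap {m : ℕ} {i j : Fin m} (hij : i ≠ j) (F : Equiv.Perm (Fin m) → ℝ) :
    ∑ π, rsign π * F π = -∑ π, rsign π * F (π * Equiv.swap i j) := by
  rw [← Equiv.sum_comp (Equiv.mulRight (Equiv.swap i j)), ← Finset.sum_neg_distrib]
  refine Finset.sum_congr rfl fun π _ => ?_
  simp [rsign, Equiv.Perm.sign_swap hij]

lemma sum_perm_swap_mul {m : ℕ} {i j : Fin m} (hij : i ≠ j) (F : Equiv.Perm (Fin m) → ℝ) :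
    ∑ π, rsign π * F π = -∑ π, rsign π * F (Equiv.swap i j * π) := by
  rw [← Equiv.sum_comp (Equiv.mulLeft (Equiv.swap i j)), ← Finset.sum_neg_distrib]
  refine Finset.sum_congr rfl fun π _ => ?_
  simp [rsign, Equiv.Perm.sign_swap hij]

/-- Every permutation of `Fin (m + 1)` factors uniquely as the inverse of a `Fin.cycleRange`
and a permutation fixing `0`. -/
lemma bijective_cycleRange_mul_liftPerm (m : ℕ) :
    Function.Bijective (fun q : Fin (m + 1) × Equiv.Perm (Fin m) =>
      (q.1.cycleRange.symm * liftPerm q.2 : Equiv.Perm (Fin (m + 1)))) := by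
  rw [Fintype.bijective_iff_injective_and_card]
  refine ⟨?_, by simp [Fintype.card_perm, Nat.factorial_succ]⟩
  rintro ⟨i, π⟩ ⟨j, ν⟩ h
  have hij : i = j := by
    have := congrArg (fun e : Equiv.Perm (Fin (m + 1)) => e 0) h
    simpa [Equiv.Perm.mul_apply, Fin.cycleRange_symm_zero] using this
  subst hij
  have h2 : liftPerm π = liftPerm ν := mul_left_cancel h
  have h3 := Equiv.Perm.decomposeFin.symm.injective h2
  simpa using h3

/-- Laplace-type expansion of an alternating sum along the value at `0`. -/
lemma sum_perm_succ_eq {m : ℕ} {X : Type*} (f : X → ℝ) (G : (Fin m → X) → ℝ)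
    (a : Fin (m + 1) → X) :
    ∑ π : Equiv.Perm (Fin (m + 1)), rsign π * (f (a (π 0)) * G (fun j => a (π j.succ))) =
      ∑ i : Fin (m + 1), (-1 : ℝ) ^ (i : ℕ) * f (a i) *
        ∑ π : Equiv.Perm (Fin m), rsign π * G (fun j => a (i.succAbove (π j))) := by
  rw [← Fintype.sum_bijective _ (bijective_cycleRange_mul_liftPerm m) _ _ (fun _ => rfl),
    Fintype.sum_prod_type]
  refine Finset.sum_congr rfl fun i _ => ?_
  rw [Finset.mul_sum]
  refine Finset.sum_congr rfl fun π _ => ?_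
  have hs : rsign (i.cycleRange.symm * liftPerm π : Equiv.Perm (Fin (m + 1))) =
      (-1 : ℝ) ^ (i : ℕ) * rsign π := by
    simp [rsign, Fin.sign_cycleRange]
  simp only [hs, Equiv.Perm.mul_apply, liftPerm_zero, liftPerm_succ, Fin.cycleRange_symm_zero,
    Fin.cycleRange_symm_succ]
  ring

lemma omitArg_eq_succAbove {X : Type*} {m : ℕ} (i : Fin (m + 1)) (a : Fin (m + 1) → X)
    (j : Fin m) : omitArg i a j = a (i.succAbove j) := by
  unfold omitArg Fin.succAbove
  simp only [Fin.lt_def, Fin.val_castSucc]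
  split_ifs <;> rfl

lemma consCast_zero {X : Type*} {m : ℕ} (c : X) (a : Fin m → X) :
    consCast (k := m + 1) c a 0 = c := by
  simp [consCast]

lemma consCast_succ {X : Type*} {m : ℕ} (c : X) (a : Fin m → X) (j : Fin m) :
    consCast (k := m + 1) c a j.succ = a j := by
  simp [consCast]

/-- The position `2 j`. -/
abbrev evenPos {p : ℕ} (j : Fin p) : Fin (2 * p) := ⟨2 * (j : ℕ), by omega⟩

/-- The position `2 j + 1`. -/
abbrev oddPos {p : ℕ} (j : Fin p) : Fin (2 * p) := ⟨2 * (j : ℕ) + 1, by omega⟩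

lemma eq_evenPos_or_eq_oddPos {p : ℕ} (i : Fin (2 * p)) :
    ∃ j : Fin p, i = evenPos j ∨ i = oddPos j := by
  refine ⟨⟨(i : ℕ) / 2, by omega⟩, ?_⟩
  simp only [Fin.ext_iff]
  omega

section PairProd

variable {E : Type*} [AddCommGroup E] [Module ℝ E]

lemma exists_prod_pair_update {p : ℕ} (β : Fin p → E →ₗ[ℝ] E →ₗ[ℝ] ℝ) (m : Fin (2 * p) → E)
    (i : Fin (2 * p)) :
    ∃ L : E →ₗ[ℝ] ℝ, ∀ x, ∏ j, β j (Function.update m i x (evenPos j))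
      (Function.update m i x (oddPos j)) = L x := by
  obtain ⟨j₀, hj⟩ := eq_evenPos_or_eq_oddPos i
  have hne : ∀ j ∈ Finset.univ.erase j₀, ∀ x,
      Function.update m i x (evenPos j) = m (evenPos j) ∧
      Function.update m i x (oddPos j) = m (oddPos j) := by
    intro j hjj x
    have h1 : (j : ℕ) ≠ j₀ := fun h => (Finset.ne_of_mem_erase hjj) (Fin.ext h)
    constructor <;> refine Function.update_of_ne ?_ _ _ <;>
      · intro h
        rcases hj with hj | hj <;> · rw [hj, Fin.ext_iff] at h; simp only at h; omega
  have hprod : ∀ x, ∏ j, β j (Function.update m i x (evenPos j))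
      (Function.update m i x (oddPos j)) =
      (∏ j ∈ Finset.univ.erase j₀, β j (m (evenPos j)) (m (oddPos j))) *
        β j₀ (Function.update m i x (evenPos j₀)) (Function.update m i x (oddPos j₀)) := by
    intro x
    rw [← Finset.prod_erase_mul _ _ (Finset.mem_univ j₀)]
    congr 1
    refine Finset.prod_congr rfl fun j hjj => ?_
    rw [(hne j hjj x).1, (hne j hjj x).2]
  have heo : evenPos j₀ ≠ oddPos j₀ := by simp [Fin.ext_iff]
  rcases hj with rfl | rfl
  · refine ⟨(∏ j ∈ Finset.univ.erase j₀, β j (m (evenPos j)) (m (oddPos j))) •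
      (β j₀).flip (m (oddPos j₀)), fun x => ?_⟩
    rw [hprod, Function.update_self, Function.update_of_ne heo.symm]
    simp
  · refine ⟨(∏ j ∈ Finset.univ.erase j₀, β j (m (evenPos j)) (m (oddPos j))) •
      (β j₀) (m (evenPos j₀)), fun x => ?_⟩
    rw [hprod, Function.update_self, Function.update_of_ne heo]
    simp

/-- The multilinear map `b ↦ ∏ⱼ βⱼ(b_{2j}, b_{2j+1})`. -/
def pairProd {p : ℕ} (β : Fin p → E →ₗ[ℝ] E →ₗ[ℝ] ℝ) :
    MultilinearMap ℝ (fun _ : Fin (2 * p) => E) ℝ where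
  toFun b := ∏ j, β j (b (evenPos j)) (b (oddPos j))
  map_update_add' := by
    intro inst m i x y
    rw [Subsingleton.elim inst (instDecidableEqFin (2 * p))]
    obtain ⟨L, hL⟩ := exists_prod_pair_update β m i
    rw [hL, hL, hL, map_add]
  map_update_smul' := by
    intro inst m i c x
    rw [Subsingleton.elim inst (instDecidableEqFin (2 * p))]
    obtain ⟨L, hL⟩ := exists_prod_pair_update β m i
    rw [hL, hL, map_smul]

lemma pairProd_apply {p : ℕ} (β : Fin p → E →ₗ[ℝ] E →ₗ[ℝ] ℝ) (b : Fin (2 * p) → E) :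
    pairProd β b = ∏ j, β j (b (evenPos j)) (b (oddPos j)) := rfl

/-- The form `(c, a) ↦ Σ_π sgn π · B(c, a_{π 0}) ∏ⱼ B(a_{π(2j+1)}, a_{π(2j+2)})`. -/
def altPairProd (p : ℕ) (B : E →ₗ[ℝ] E →ₗ[ℝ] ℝ) :
    MultilinearMap ℝ (fun _ : Fin (2 * p + 2) => E) ℝ :=
  ∑ π : Equiv.Perm (Fin (2 * p + 1)),
    rsign π • (pairProd (fun _ : Fin (p + 1) => B)).domDomCongr (liftPerm π)

lemma altPairProd_apply (p : ℕ) (B : E →ₗ[ℝ] E →ₗ[ℝ] ℝ) (v : Fin (2 * p + 2) → E) :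
    altPairProd p B v = ∑ π : Equiv.Perm (Fin (2 * p + 1)), rsign π *
      (B (v 0) (v (π 0).succ) * ∏ j : Fin p,
        B (v (π (evenPos j).succ).succ) (v (π (oddPos j).succ).succ)) := by
  rw [altPairProd, sum_apply]
  refine Finset.sum_congr rfl fun π _ => ?_
  rw [smul_apply, MultilinearMap.domDomCongr_apply, pairProd_apply,
    Fin.prod_univ_succ, smul_eq_mul]
  congr 2

lemma altPairProd_eq_zero_of_succ_eq (p : ℕ) (B : E →ₗ[ℝ] E →ₗ[ℝ] ℝ) (v : Fin (2 * p + 2) → E)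
    {i j : Fin (2 * p + 1)} (hij : i ≠ j) (h : v i.succ = v j.succ) :
    altPairProd p B v = 0 := by
  have hv : ∀ l, v (Equiv.swap i j l).succ = v l.succ := by
    intro l
    rcases eq_or_ne l i with rfl | hi
    · rw [Equiv.swap_apply_left, h]
    rcases eq_or_ne l j with rfl | hj
    · rw [Equiv.swap_apply_right, h]
    rw [Equiv.swap_apply_of_ne_of_ne hi hj]
  have key := sum_perm_swap_mul hij (fun π => B (v 0) (v (π 0).succ) * ∏ j : Fin p,
        B (v (π (evenPos j).succ).succ) (v (π (oddPos j).succ).succ))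
  simp only [Equiv.Perm.mul_apply, hv] at key
  rw [altPairProd_apply]
  linarith

lemma altPairProd_eq_zero_of_zero_eq (p : ℕ) (B : E →ₗ[ℝ] E →ₗ[ℝ] ℝ) (hB : ∀ b, B b b = 0)
    (v : Fin (2 * p + 2) → E) (k : Fin (2 * p + 1)) (h : v 0 = v k.succ) :
    altPairProd p B v = 0 := by
  have hB' : ∀ b c, B b c = -B c b := fun b c => by
    have := hB (b + c)
    simp only [map_add, LinearMap.add_apply, hB] at this
    linarith
  set F : Equiv.Perm (Fin (2 * p + 1)) → ℝ := fun π => B (v 0) (v (π 0).succ) * ∏ j : Fin p,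
        B (v (π (evenPos j).succ).succ) (v (π (oddPos j).succ).succ) with hF
  have hsum : altPairProd p B v =
      ∑ q, ∑ π : Equiv.Perm (Fin (2 * p + 1)), rsign π * (if π q = k then F π else 0) := by
    rw [altPairProd_apply, Finset.sum_comm]
    refine Finset.sum_congr rfl fun π _ => ?_
    rw [← Finset.mul_sum, Finset.sum_eq_single (π.symm k)]
    · simp [hF]
    · intro q _ hq
      rw [if_neg]
      rintro rfl
      simp at hq
    · simp
  rw [hsum]
  refine Finset.sum_eq_zero fun q _ => ?_
  rcases Fin.eq_zero_or_eq_succ q with rfl | ⟨q', rfl⟩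
  · refine Finset.sum_eq_zero fun π _ => ?_
    split_ifs with hk
    · simp [hF, hk, ← h, hB]
    · simp
  obtain ⟨j₀, hj⟩ := eq_evenPos_or_eq_oddPos q'
  obtain ⟨r, hr⟩ : ∃ r : Fin (2 * p), (q' = evenPos j₀ ∧ r = oddPos j₀) ∨
      (q' = oddPos j₀ ∧ r = evenPos j₀) := by
    rcases hj with hj | hj
    · exact ⟨_, Or.inl ⟨hj, rfl⟩⟩
    · exact ⟨_, Or.inr ⟨hj, rfl⟩⟩
  have hqr : q' ≠ r := by
    rcases hr with ⟨h1, h2⟩ | ⟨h1, h2⟩ <;> simp [h1, h2, Fin.ext_iff]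
  have key := sum_perm_mul_swap (Fin.succ_ne_zero r).symm
    (fun π => if π q'.succ = k then F π else 0)
  suffices hsymm : ∀ π : Equiv.Perm (Fin (2 * p + 1)),
      (if (π * Equiv.swap 0 r.succ) q'.succ = k then F (π * Equiv.swap 0 r.succ) else 0) =
        if π q'.succ = k then F π else 0 by
    simp only [hsymm] at key
    linarith
  intro π
  have hq : Equiv.swap 0 r.succ q'.succ = q'.succ :=
    Equiv.swap_apply_of_ne_of_ne (Fin.succ_ne_zero _) (by simpa using hqr)
  rw [Equiv.Perm.mul_apply, hq]
  split_ifs with hk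
  · simp only [hF]
    rw [← Finset.prod_erase_mul _ _ (Finset.mem_univ j₀),
      ← Finset.prod_erase_mul _ _ (Finset.mem_univ j₀)]
    have hoff : ∏ j ∈ Finset.univ.erase j₀,
        B (v ((π * Equiv.swap 0 r.succ) (evenPos j).succ).succ)
          (v ((π * Equiv.swap 0 r.succ) (oddPos j).succ).succ) =
        ∏ j ∈ Finset.univ.erase j₀,
          B (v (π (evenPos j).succ).succ) (v (π (oddPos j).succ).succ) := by
      refine Finset.prod_congr rfl fun j hjj => ?_
      have h1 : (j : ℕ) ≠ j₀ := fun h => (Finset.ne_of_mem_erase hjj) (Fin.ext h)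
      have h2 : evenPos j ≠ r := by
        rcases hr with ⟨_, h2⟩ | ⟨_, h2⟩ <;> rw [h2, Ne, Fin.ext_iff] <;> simp only <;> omega
      have h3 : oddPos j ≠ r := by
        rcases hr with ⟨_, h2⟩ | ⟨_, h2⟩ <;> rw [h2, Ne, Fin.ext_iff] <;> simp only <;> omega
      rw [Equiv.Perm.mul_apply, Equiv.Perm.mul_apply,
        Equiv.swap_apply_of_ne_of_ne (Fin.succ_ne_zero _) fun h' => h2 (Fin.succ_injective _ h'),
        Equiv.swap_apply_of_ne_of_ne (Fin.succ_ne_zero _) fun h' => h3 (Fin.succ_injective _ h')]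
    rw [hoff]
    rcases hr with ⟨h1, h2⟩ | ⟨h1, h2⟩
    · rw [h1] at hq hk
      rw [h2] at hq ⊢
      simp only [Equiv.Perm.mul_apply, hq, hk, Equiv.swap_apply_left, Equiv.swap_apply_right, ← h]
      ring
    · rw [h1] at hq hk
      rw [h2] at hq ⊢
      simp only [Equiv.Perm.mul_apply, hq, hk, Equiv.swap_apply_left, Equiv.swap_apply_right, ← h]
      rw [hB' _ (v 0), hB' _ (v 0)]
      ring
  · rfl

lemma altPairProd_eq_zero_of_eq (p : ℕ) (B : E →ₗ[ℝ] E →ₗ[ℝ] ℝ) (hB : ∀ b, B b b = 0)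
    (v : Fin (2 * p + 2) → E) (i j : Fin (2 * p + 2)) (hij : i ≠ j) (h : v i = v j) :
    altPairProd p B v = 0 := by
  rcases Fin.eq_zero_or_eq_succ i with rfl | ⟨i', rfl⟩ <;>
    rcases Fin.eq_zero_or_eq_succ j with rfl | ⟨j', rfl⟩
  · exact absurd rfl hij
  · exact altPairProd_eq_zero_of_zero_eq p B hB v j' h
  · exact altPairProd_eq_zero_of_zero_eq p B hB v i' h.symm
  · exact altPairProd_eq_zero_of_succ_eq p B v (fun h' => hij (congrArg _ h')) h

end PairProd

/-- A multilinear map on Euclidean space, as a continuous multilinear map written in the standard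
coordinates. -/
def formOf {n k : ℕ} (g : MultilinearMap ℝ (fun _ : Fin k => Euc n) ℝ) : FormML n k :=
  ∑ s : Fin k → Fin n, g (fun i => EuclideanSpace.basisFun (Fin n) ℝ (s i)) •
    (ContinuousMultilinearMap.mkPiAlgebra ℝ (Fin k) ℝ).compContinuousLinearMap
      (fun i => EuclideanSpace.proj (s i))

lemma formOf_apply {n k : ℕ} (g : MultilinearMap ℝ (fun _ : Fin k => Euc n) ℝ)
    (a : Fin k → Euc n) : formOf g a = g a := by
  suffices h : (formOf g).toMultilinearMap = g from congrArg (fun f => f a) h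
  refine Module.Basis.ext_multilinear
    (fun _ => (EuclideanSpace.basisFun (Fin n) ℝ).toBasis) fun v => ?_
  simp only [OrthonormalBasis.coe_toBasis, ContinuousMultilinearMap.coe_coe, formOf,
    sum_apply, smul_apply,
    ContinuousMultilinearMap.compContinuousLinearMap_apply,
    ContinuousMultilinearMap.mkPiAlgebra_apply]
  rw [Finset.sum_eq_single v]
  · simp
  · intro s _ hs
    obtain ⟨i, hi⟩ := Function.ne_iff.1 hs
    rw [Finset.prod_eq_zero (Finset.mem_univ i), smul_zero]
    simp [hi]
  · simp

lemma contDiffOn_formOf {n k : ℕ} {U : Set (Euc n)}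
    {g : Euc n → MultilinearMap ℝ (fun _ : Fin k => Euc n) ℝ}
    (hg : ∀ a, ContDiffOn ℝ (⊤ : ℕ∞) (fun x => g x a) U) :
    ContDiffOn ℝ (⊤ : ℕ∞) (fun x => formOf (g x)) U :=
  ContDiffOn.sum fun _ _ => (hg _).smul contDiffOn_const

lemma formML_one_add {n : ℕ} (f : FormML n 1) (b c : Euc n) :
    f ![b + c] = f ![b] + f ![c] := by
  have hu : ∀ u : Euc n, Function.update ![b] 0 u = ![u] := fun u => by
    funext j; fin_cases j; rfl
  have := f.map_update_add ![b] 0 b c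
  rwa [hu, hu, hu] at this

lemma formML_one_smul {n : ℕ} (f : FormML n 1) (r : ℝ) (b : Euc n) :
    f ![r • b] = r * f ![b] := by
  have hu : ∀ u : Euc n, Function.update ![b] 0 u = ![u] := fun u => by
    funext j; fin_cases j; rfl
  have := f.map_update_smul ![b] 0 r b
  rwa [hu, hu] at this

/-- The linear functional of a `1`-form. -/
def oneForm {n : ℕ} (f : FormML n 1) : Euc n →ₗ[ℝ] ℝ where
  toFun b := f ![b]
  map_add' := formML_one_add f
  map_smul' := formML_one_smul f

lemma oneForm_apply {n : ℕ} (f : FormML n 1) (b : Euc n) : oneForm f b = f ![b] := rfl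

/-- `muTwo` as a bilinear map. -/
def muBilin {n : ℕ} (σ : Euc n → FormML n 1) (y : Euc n) : Euc n →ₗ[ℝ] Euc n →ₗ[ℝ] ℝ :=
  LinearMap.mk₂ ℝ (muTwo n σ y)
    (fun b b' c => by simp [muTwo, formML_one_add]; ring)
    (fun r b c => by simp [muTwo, formML_one_smul]; ring)
    (fun b c c' => by simp [muTwo, formML_one_add]; ring)
    (fun r b c => by simp [muTwo, formML_one_smul]; ring)

lemma muBilin_apply {n : ℕ} (σ : Euc n → FormML n 1) (y b c : Euc n) :
    muBilin σ y b c = muTwo n σ y b c := rfl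

/-- The analytic consequences of the conformal Killing equation for a `1`-form: there is a smooth
function `φ` with `∇σ = φ g + μ` and `∇_c μ = dφ ∧ c`. -/
lemma FlatCKF.exists_prolongation {n : ℕ} {U : Set (Euc n)} (hU : IsOpen U)
    {σ : Euc n → FormML n 1} (hσ : FlatCKF n 1 U σ) :
    ∃ φ : Euc n → ℝ, ContDiffOn ℝ (⊤ : ℕ∞) φ U ∧
      (∀ b c, ContDiffOn ℝ (⊤ : ℕ∞) (fun y => muTwo n σ y b c) U) ∧
      (∀ x ∈ U, ∀ c a, fderiv ℝ (fun y => σ y ![a]) x c = ⟪c, a⟫ * φ x + muTwo n σ x c a) ∧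
      (∀ x ∈ U, ∀ c a b, fderiv ℝ (fun y => muTwo n σ y a b) x c =
        ⟪c, b⟫ * fderiv ℝ φ x a - ⟪c, a⟫ * fderiv ℝ φ x b) := by
  obtain ⟨hs, -, τ, ρ, hτ, -, -, hρalt, heq⟩ := hσ
  set D : Euc n → Euc n → Euc n → ℝ := fun y c a => fderiv ℝ σ y c ![a] with hD
  have hfd : ContDiffOn ℝ (⊤ : ℕ∞) (fderiv ℝ σ) U := hs.fderiv_of_isOpen hU (by simp)
  have hev : ∀ (k : ℕ) (v : Fin k → Euc n) (f : Euc n → FormML n k),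
      ContDiffOn ℝ (⊤ : ℕ∞) f U → ContDiffOn ℝ (⊤ : ℕ∞) (fun y => f y v) U := fun k v f hf =>
    (ContinuousMultilinearMap.apply ℝ (fun _ : Fin k => Euc n) ℝ v).contDiff.comp_contDiffOn hf
  have hDs : ∀ c a, ContDiffOn ℝ (⊤ : ℕ∞) (fun y => D y c a) U := fun c a =>
    hev 1 ![a] _ (hfd.clm_apply contDiffOn_const)
  have hμs : ∀ b c, ContDiffOn ℝ (⊤ : ℕ∞) (fun y => muTwo n σ y b c) U := fun b c =>
    contDiffOn_const.mul ((hDs b c).sub (hDs c b))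
  have hD1 : ∀ x ∈ U, ∀ c a, D x c a =
      ⟪c, a⟫ * τ x (omitArg 0 ![0]) + ρ x (consCast c ![a]) := by
    intro x hx c a
    have h0 : omitArg (0 : Fin 1) ![a] = omitArg 0 ![0] := by
      funext j; exact j.elim0
    have := heq x hx c ![a]
    simpa [hD, h0] using this
  have hρ : ∀ x ∈ U, ∀ c a, ρ x (consCast c ![a]) = - ρ x (consCast a ![c]) := by
    intro x hx c a
    have hcons : ∀ u v : Euc n, consCast (k := 2) u ![v] = ![u, v] := by
      intro u v; funext j; fin_cases j <;> simp [consCast]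
    have hself : ∀ u, ρ x ![u, u] = 0 := fun u =>
      hρalt x hx ![u, u] 0 1 (by simp) (by simp)
    have hu0 : ∀ u v w : Euc n, Function.update ![u, v] 0 w = ![w, v] := fun u v w => by
      funext j; fin_cases j <;> rfl
    have hu1 : ∀ u v w : Euc n, Function.update ![u, v] 1 w = ![u, w] := fun u v w => by
      funext j; fin_cases j <;> rfl
    have hadd1 : ∀ u u' v, ρ x ![u + u', v] = ρ x ![u, v] + ρ x ![u', v] := fun u u' v => by
      have := (ρ x).map_update_add ![u, v] 0 u u'
      rwa [hu0, hu0, hu0] at this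
    have hadd2 : ∀ u v v', ρ x ![u, v + v'] = ρ x ![u, v] + ρ x ![u, v'] := fun u v v' => by
      have := (ρ x).map_update_add ![u, v] 1 v v'
      rwa [hu1, hu1, hu1] at this
    have := hself (c + a)
    rw [hadd1, hadd2, hadd2, hself, hself] at this
    have e1 := hcons c a
    have e2 := hcons a c
    rw [e1, e2]
    linarith
  refine ⟨fun y => τ y (omitArg 0 ![0]), hev _ _ _ hτ, hμs, ?_, ?_⟩
  · intro x hx c a
    have hd : DifferentiableAt ℝ σ x := (hs.contDiffAt (hU.mem_nhds hx)).differentiableAt (by simp)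
    have h1 : fderiv ℝ (fun y => σ y ![a]) x c = D x c a := by
      have := ((ContinuousMultilinearMap.apply ℝ (fun _ : Fin 1 => Euc n) ℝ
        ![a]).hasFDerivAt.comp x hd.hasFDerivAt).fderiv
      exact congrArg (fun L : Euc n →L[ℝ] ℝ => L c) this
    have h2 : muTwo n σ x c a = (1 / 2) * (D x c a - D x a c) := rfl
    rw [h1, h2, hD1 x hx c a, hD1 x hx a c, hρ x hx a c, real_inner_comm a c]
    ring
  · intro x hx c a b
    have hat := hs.contDiffAt (hU.mem_nhds hx)
    have hdd : DifferentiableAt ℝ (fderiv ℝ σ) x :=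
      (hfd.contDiffAt (hU.mem_nhds hx)).differentiableAt (by simp)
    have hH : ∀ u v, HasFDerivAt (fun y => D y u v)
        ((ContinuousMultilinearMap.apply ℝ (fun _ : Fin 1 => Euc n) ℝ ![v]).comp
          ((fderiv ℝ (fderiv ℝ σ) x).flip u)) x := fun u v => by
      have h1 : HasFDerivAt (fun y => fderiv ℝ σ y u) ((fderiv ℝ (fderiv ℝ σ) x).flip u) x := by
        simpa using hdd.hasFDerivAt.clm_apply (hasFDerivAt_const u x)
      exact (ContinuousMultilinearMap.apply ℝ (fun _ : Fin 1 => Euc n) ℝ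
        ![v]).hasFDerivAt.comp x h1
    set H : Euc n → Euc n → Euc n → ℝ := fun d u v => fderiv ℝ (fderiv ℝ σ) x d u ![v]
    have hHv : ∀ d u v, fderiv ℝ (fun y => D y u v) x d = H d u v := fun d u v => by
      rw [(hH u v).fderiv]; rfl
    have hsymm : ∀ d u v, H d u v = H u d v := fun d u v => by
      have h2 : minSmoothness ℝ 2 ≤ ((⊤ : ℕ∞) : WithTop ℕ∞) := by
        rw [minSmoothness_of_isRCLikeNormedField]
        exact WithTop.coe_le_coe.2 (le_top : (2 : ℕ∞) ≤ ⊤)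
      have := hat.isSymmSndFDerivAt h2 d u
      exact congrArg (fun f : FormML n 1 => f ![v]) this
    have hφ : DifferentiableAt ℝ (fun y => τ y (omitArg 0 ![0])) x :=
      ((hev _ _ _ hτ).contDiffAt (hU.mem_nhds hx)).differentiableAt (by simp)
    have hsum : ∀ d u v, H d u v + H d v u =
        2 * ⟪u, v⟫ * fderiv ℝ (fun y => τ y (omitArg 0 ![0])) x d := by
      intro d u v
      have hev : (fun y => D y u v + D y v u) =ᶠ[nhds x]
          fun y => (2 * ⟪u, v⟫) * τ y (omitArg 0 ![0]) := by
        filter_upwards [hU.mem_nhds hx] with y hy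
        rw [hD1 y hy u v, hD1 y hy v u, hρ y hy u v, real_inner_comm v u]
        ring
      have h1 := hev.fderiv_eq (𝕜 := ℝ)
      have h2 := ((hH u v).add (hH v u)).fderiv
      have h3 := (hφ.hasFDerivAt.const_mul (2 * ⟪u, v⟫)).fderiv
      have h4 := congrArg (fun L : Euc n →L[ℝ] ℝ => L d) ((h2.symm.trans h1).trans h3)
      exact h4
    have hμ : fderiv ℝ (fun y => muTwo n σ y a b) x c = (1 / 2) * (H c a b - H c b a) := by
      have := (((hH a b).sub (hH b a)).const_mul (1 / 2 : ℝ)).fderiv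
      exact congrArg (fun L : Euc n →L[ℝ] ℝ => L c) this
    rw [hμ]
    have e1 := hsum a c b
    have e2 := hsum b c a
    have e3 := hsymm c a b
    have e4 := hsymm c b a
    have e5 := hsymm a b c
    linarith
section Leibniz

variable {E : Type*} [AddCommGroup E] [Module ℝ E]

/-- The multilinear map whose alternatization is (up to scale) `φ μᵖ + p ψ ∧ η ∧ μᵖ⁻¹`. -/
def tauMultilinear (p : ℕ) (φ : ℝ) (B : E →ₗ[ℝ] E →ₗ[ℝ] ℝ) (ψ η : E →ₗ[ℝ] ℝ) :
    MultilinearMap ℝ (fun _ : Fin (2 * p) => E) ℝ :=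
  φ • pairProd (fun _ => B) +
    (2 : ℝ) • ∑ j : Fin p, pairProd (Function.update (fun _ => B) j (ψ.smulRight η))

lemma tauMultilinear_apply (p : ℕ) (φ : ℝ) (B : E →ₗ[ℝ] E →ₗ[ℝ] ℝ) (ψ η : E →ₗ[ℝ] ℝ)
    (b : Fin (2 * p) → E) :
    tauMultilinear p φ B ψ η b = φ * ∏ j, B (b (evenPos j)) (b (oddPos j)) +
      2 * ∑ j : Fin p, (∏ i ∈ Finset.univ.erase j, B (b (evenPos i)) (b (oddPos i))) *
        (ψ (b (evenPos j)) * η (b (oddPos j))) := by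
  simp only [tauMultilinear, add_apply, smul_apply, sum_apply, pairProd_apply, smul_eq_mul]
  congr 2
  refine Finset.sum_congr rfl fun j _ => ?_
  rw [← Finset.prod_erase_mul _ _ (Finset.mem_univ j)]
  congr 1
  · refine Finset.prod_congr rfl fun i hi => ?_
    rw [Function.update_of_ne (Finset.ne_of_mem_erase hi)]
  · simp

lemma alternatization_apply_eq {m : ℕ} (G : MultilinearMap ℝ (fun _ : Fin m => E) ℝ)
    (b : Fin m → E) :
    MultilinearMap.alternatization G b =
      ∑ π : Equiv.Perm (Fin m), rsign π * G (fun j => b (π j)) := by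
  rw [MultilinearMap.alternatization_apply]
  refine Finset.sum_congr rfl fun π _ => ?_
  rw [MultilinearMap.domDomCongr_apply, Units.smul_def, zsmul_eq_mul]

lemma sum_perm_shuffle {p : ℕ} (B : E →ₗ[ℝ] E →ₗ[ℝ] ℝ) (ψ η ξ : E →ₗ[ℝ] ℝ)
    (a : Fin (2 * p + 1) → E) (j : Fin p) :
    ∑ π : Equiv.Perm (Fin (2 * p + 1)), rsign π * (ψ (a (π 0)) *
      ((∏ i ∈ Finset.univ.erase j, B (a (π (evenPos i).succ)) (a (π (oddPos i).succ))) *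
        (ξ (a (π (oddPos j).succ)) * η (a (π (evenPos j).succ)) -
          ξ (a (π (evenPos j).succ)) * η (a (π (oddPos j).succ))))) =
    ∑ π : Equiv.Perm (Fin (2 * p + 1)), rsign π * (ξ (a (π 0)) *
      (2 * ((∏ i ∈ Finset.univ.erase j, B (a (π (evenPos i).succ)) (a (π (oddPos i).succ))) *
        (ψ (a (π (evenPos j).succ)) * η (a (π (oddPos j).succ)))))) := by
  set R : Equiv.Perm (Fin (2 * p + 1)) → ℝ := fun π =>
    ∏ i ∈ Finset.univ.erase j, B (a (π (evenPos i).succ)) (a (π (oddPos i).succ)) with hR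
  have hne : ∀ i ∈ Finset.univ.erase j, ((i : ℕ) ≠ j) := fun i hi h =>
    (Finset.ne_of_mem_erase hi) (Fin.ext h)
  have heo : (evenPos j).succ ≠ (oddPos j).succ := by simp [Fin.ext_iff]
  have h0e : 0 ≠ (evenPos j).succ := (Fin.succ_ne_zero _).symm
  have h0o : 0 ≠ (oddPos j).succ := (Fin.succ_ne_zero _).symm
  have hR1 : ∀ π, R (π * Equiv.swap (evenPos j).succ (oddPos j).succ) = R π := fun π => by
    refine Finset.prod_congr rfl fun i hi => ?_
    have := hne i hi
    rw [Equiv.Perm.mul_apply, Equiv.Perm.mul_apply, Equiv.swap_apply_of_ne_of_ne,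
      Equiv.swap_apply_of_ne_of_ne] <;> rw [Ne, Fin.ext_iff] <;> simp <;> omega
  have hR2 : ∀ π, R (π * Equiv.swap 0 (evenPos j).succ) = R π := fun π => by
    refine Finset.prod_congr rfl fun i hi => ?_
    have := hne i hi
    rw [Equiv.Perm.mul_apply, Equiv.Perm.mul_apply, Equiv.swap_apply_of_ne_of_ne,
      Equiv.swap_apply_of_ne_of_ne] <;> rw [Ne, Fin.ext_iff] <;> simp <;> omega
  have k1 := sum_perm_mul_swap heo (fun π => ψ (a (π 0)) *
    (R π * (ξ (a (π (oddPos j).succ)) * η (a (π (evenPos j).succ)))))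
  have k2 := sum_perm_mul_swap h0e (fun π => ψ (a (π 0)) *
    (R π * (ξ (a (π (evenPos j).succ)) * η (a (π (oddPos j).succ)))))
  simp only [hR1, hR2] at k1 k2
  simp only [Equiv.Perm.mul_apply, Equiv.swap_apply_left, Equiv.swap_apply_right,
    Equiv.swap_apply_of_ne_of_ne h0e h0o, Equiv.swap_apply_of_ne_of_ne h0o.symm heo.symm] at k1 k2
  have e1 : ∑ π : Equiv.Perm (Fin (2 * p + 1)), rsign π * (ψ (a (π 0)) * (R π *
        (ξ (a (π (oddPos j).succ)) * η (a (π (evenPos j).succ)) -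
          ξ (a (π (evenPos j).succ)) * η (a (π (oddPos j).succ))))) =
      ∑ π, rsign π * (ψ (a (π 0)) *
        (R π * (ξ (a (π (oddPos j).succ)) * η (a (π (evenPos j).succ))))) -
      ∑ π, rsign π * (ψ (a (π 0)) *
        (R π * (ξ (a (π (evenPos j).succ)) * η (a (π (oddPos j).succ))))) := by
    rw [← Finset.sum_sub_distrib]
    exact Finset.sum_congr rfl fun π _ => by ring
  have e2 : ∑ π : Equiv.Perm (Fin (2 * p + 1)), rsign π * (ξ (a (π 0)) *
      (2 * (R π * (ψ (a (π (evenPos j).succ)) * η (a (π (oddPos j).succ)))))) =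
      2 * ∑ π, rsign π * (ψ (a (π (evenPos j).succ)) *
        (R π * (ξ (a (π 0)) * η (a (π (oddPos j).succ))))) := by
    rw [Finset.mul_sum]
    exact Finset.sum_congr rfl fun π _ => by ring
  rw [e1, e2, k1, k2]
  ring

/-- The algebraic form of the conformal Killing equation for `ψ ∧ μᵖ`. -/
lemma sum_perm_leibniz (p : ℕ) (φ : ℝ) (B : E →ₗ[ℝ] E →ₗ[ℝ] ℝ) (ψ η ξ : E →ₗ[ℝ] ℝ) (c : E)
    (a : Fin (2 * p + 1) → E) :
    ∑ π : Equiv.Perm (Fin (2 * p + 1)), rsign π *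
      ((ξ (a (π 0)) * φ + B c (a (π 0))) *
          (∏ j : Fin p, B (a (π (evenPos j).succ)) (a (π (oddPos j).succ))) +
        ψ (a (π 0)) * ∑ j : Fin p,
          (∏ i ∈ Finset.univ.erase j, B (a (π (evenPos i).succ)) (a (π (oddPos i).succ))) *
          (ξ (a (π (oddPos j).succ)) * η (a (π (evenPos j).succ)) -
            ξ (a (π (evenPos j).succ)) * η (a (π (oddPos j).succ)))) =
      (∑ i : Fin (2 * p + 1), (-1 : ℝ) ^ (i : ℕ) * ξ (a i) *
        MultilinearMap.alternatization (tauMultilinear p φ B ψ η) (omitArg i a)) +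
      altPairProd p B (consCast c a) := by
  have hL := sum_perm_succ_eq (fun b => ξ b) (fun b => tauMultilinear p φ B ψ η b) a
  have hO : ∀ i, omitArg i a = fun j => a (i.succAbove j) := fun i =>
    funext fun j => omitArg_eq_succAbove i a j
  simp only [hO, alternatization_apply_eq]
  rw [← hL, altPairProd_apply]
  have hc0 : consCast (k := 2 * p + 1 + 1) c a 0 = c := consCast_zero c a
  have hcs : ∀ j : Fin (2 * p + 1), consCast (k := 2 * p + 1 + 1) c a j.succ = a j :=
    consCast_succ c a
  simp only [hc0, hcs, tauMultilinear_apply]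
  have hsh : ∑ π : Equiv.Perm (Fin (2 * p + 1)), rsign π * (ψ (a (π 0)) * ∑ j : Fin p,
          (∏ i ∈ Finset.univ.erase j, B (a (π (evenPos i).succ)) (a (π (oddPos i).succ))) *
          (ξ (a (π (oddPos j).succ)) * η (a (π (evenPos j).succ)) -
            ξ (a (π (evenPos j).succ)) * η (a (π (oddPos j).succ)))) =
      ∑ π : Equiv.Perm (Fin (2 * p + 1)), rsign π * (ξ (a (π 0)) * (2 * ∑ j : Fin p,
        (∏ i ∈ Finset.univ.erase j, B (a (π (evenPos i).succ)) (a (π (oddPos i).succ))) *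
        (ψ (a (π (evenPos j).succ)) * η (a (π (oddPos j).succ))))) := by
    simp only [Finset.mul_sum]
    rw [Finset.sum_comm, Finset.sum_comm (s := Finset.univ (α := Equiv.Perm (Fin (2 * p + 1))))]
    exact Finset.sum_congr rfl fun j _ => sum_perm_shuffle B ψ η ξ a j
  simp only [mul_add, add_mul, Finset.sum_add_distrib] at hsh ⊢
  rw [hsh]
  have : ∀ π : Equiv.Perm (Fin (2 * p + 1)), ∀ P : ℝ, rsign π * (ξ (a (π 0)) * φ * P) =
      rsign π * (ξ (a (π 0)) * (φ * P)) := fun π P => by ring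
  simp only [this]
  ring

end Leibniz

/-- For a flat conformal Killing 1-form `σ` with `μ = dσ/2`, the
`(2p+1)`-form `σ ∧ μᵖ` satisfies the flat conformal Killing equation for
`(2p+1)`-forms. -/
theorem flat_conformal_killing_sigma_mu_power
    (n p : ℕ) (hn : 3 ≤ n) (hp : 1 ≤ p) (hpn : 2 * p + 1 ≤ n - 1)
    (U : Set (Euc n)) (hU : IsOpen U)
    (σ : Euc n → FormML n 1) (hσ : FlatCKF n 1 U σ) :
    ∃ (τ' : Euc n → FormML n (2 * p)) (ρ' : Euc n → FormML n (2 * p + 2)),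
      ContDiffOn ℝ (⊤ : ℕ∞) τ' U ∧ ContDiffOn ℝ (⊤ : ℕ∞) ρ' U ∧
      (∀ x ∈ U, IsAlt (τ' x)) ∧ (∀ x ∈ U, IsAlt (ρ' x)) ∧
      ∀ x ∈ U, ∀ (c : Euc n) (a : Fin (2 * p + 1) → Euc n),
        fderiv ℝ (fun y => sigmaMuPow n p σ y a) x c
        = (∑ i : Fin (2 * p + 1), (-1 : ℝ) ^ (i : ℕ) * ⟪c, a i⟫ * τ' x (omitArg i a))
          + ρ' x (consCast c a) := by
  obtain ⟨φ, hφ, hμ, hdσ, hdμ⟩ := hσ.exists_prolongation hU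
  have hs : ∀ b, ContDiffOn ℝ (⊤ : ℕ∞) (fun y => σ y ![b]) U := fun b =>
    (ContinuousMultilinearMap.apply ℝ (fun _ : Fin 1 => Euc n) ℝ ![b]).contDiff.comp_contDiffOn
      hσ.1
  have hdφ : ∀ b, ContDiffOn ℝ (⊤ : ℕ∞) (fun y => fderiv ℝ φ y b) U := fun b =>
    (hφ.fderiv_of_isOpen hU (by simp)).clm_apply contDiffOn_const
  refine ⟨fun x => formOf (MultilinearMap.alternatization (tauMultilinear p (φ x) (muBilin σ x)
      (oneForm (σ x)) (fderiv ℝ φ x).toLinearMap)).toMultilinearMap,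
    fun x => formOf (altPairProd p (muBilin σ x)), ?_, ?_, ?_, ?_, ?_⟩
  · refine contDiffOn_formOf fun b => ?_
    simp only [AlternatingMap.coe_multilinearMap, alternatization_apply_eq, tauMultilinear_apply,
      muBilin_apply, oneForm_apply, ContinuousLinearMap.coe_coe]
    exact ContDiffOn.sum fun π _ => contDiffOn_const.mul <|
      (hφ.mul (contDiffOn_prod fun j _ => hμ _ _)).add <| contDiffOn_const.mul <|
        ContDiffOn.sum fun j _ => (contDiffOn_prod fun i _ => hμ _ _).mul ((hs _).mul (hdφ _))
  · refine contDiffOn_formOf fun b => ?_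
    simp only [altPairProd_apply, muBilin_apply]
    exact ContDiffOn.sum fun π _ => contDiffOn_const.mul <|
      (hμ _ _).mul (contDiffOn_prod fun j _ => hμ _ _)
  · intro x _ v i j hij h
    rw [formOf_apply]
    exact AlternatingMap.map_eq_zero_of_eq _ v h hij
  · intro x _ v i j hij h
    rw [formOf_apply]
    exact altPairProd_eq_zero_of_eq p _ (fun b => by simp [muBilin_apply, muTwo]) v i j hij h
  · intro x hx c a
    have hds : ∀ b, HasFDerivAt (fun y => σ y ![b]) (fderiv ℝ (fun y => σ y ![b]) x) x := fun b =>
      (((hs b).contDiffAt (hU.mem_nhds hx)).differentiableAt (by simp)).hasFDerivAt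
    have hdm : ∀ b d, HasFDerivAt (fun y => muTwo n σ y b d)
        (fderiv ℝ (fun y => muTwo n σ y b d) x) x := fun b d =>
      (((hμ b d).contDiffAt (hU.mem_nhds hx)).differentiableAt (by simp)).hasFDerivAt
    have hT : HasFDerivAt (fun y => sigmaMuPow n p σ y a) _ x :=
      HasFDerivAt.fun_sum (u := Finset.univ) fun (π : Equiv.Perm (Fin (2 * p + 1))) _ =>
        ((hds (a (π 0))).mul (HasFDerivAt.finsetProd (u := Finset.univ) fun (j : Fin p) _ =>
          hdm (a (π (evenPos j).succ)) (a (π (oddPos j).succ)))).const_mul (rsign π)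
    have key := sum_perm_leibniz p (φ x) (muBilin σ x) (oneForm (σ x))
      (fderiv ℝ φ x).toLinearMap (innerSL ℝ c).toLinearMap c a
    simp only [formOf_apply, AlternatingMap.coe_multilinearMap]
    refine Eq.trans ?_ key
    rw [hT.fderiv]
    simp only [sum_apply, add_apply, smul_apply, smul_eq_mul, hdσ x hx, hdμ x hx,
      muBilin_apply, oneForm_apply, ContinuousLinearMap.coe_coe, innerSL_apply_apply]
    refine Finset.sum_congr rfl fun π _ => ?_
    ring
end
end
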